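/- Let 0 ≤ α < γ'/N and let m ∈ L^{α+1}(Q) be a nonnegative weak solution of the Fokker–Planck equation with drift A and initial datum m₀. Then there exist C > 0 and δ > 1, depending only on T, α, N, γ and ‖∇m₀‖_{L^∞(T^N)}, such that ( ∫_Q m^{α+1} dx dt )^δ ≤ C ( E + 1 ). -/

import Mathlib

open MeasureTheory Set Filter Topology

noncomputable section

/-- Points of `ℝ^N`.  `ℤ^N`-periodic functions on `RN N` model functions on the
flat torus `T^N`. -/
abbrev RN (N : ℕ) := Fin N → ℝ

/-- The Euclidean norm on `ℝ^N`. -/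
def euclNorm {N : ℕ} (p : RN N) : ℝ := Real.sqrt (∑ i, p i ^ 2)

/-- The Euclidean inner product on `ℝ^N`. -/
def dotp {N : ℕ} (p q : RN N) : ℝ := ∑ i, p i * q i

/-- `ℤ^N`-periodicity: such functions are exactly the functions on the flat torus `T^N`. -/
def ZPeriodic {N : ℕ} {β : Type*} (u : RN N → β) : Prop :=
  ∀ (x : RN N) (z : Fin N → ℤ), u (fun i => x i + (z i : ℝ)) = u x

/-- Partial derivative in the `i`-th coordinate direction. -/
def pd {N : ℕ} (i : Fin N) (u : RN N → ℝ) (x : RN N) : ℝ := fderiv ℝ u x (Pi.single i 1)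

/-- Spatial gradient. -/
def grad {N : ℕ} (u : RN N → ℝ) (x : RN N) : RN N := fun i => pd i u x

/-- Divergence of a vector field. -/
def dive {N : ℕ} (w : RN N → RN N) (x : RN N) : ℝ := ∑ i, pd i (fun y => w y i) x

/-- Laplacian. -/
def lap {N : ℕ} (u : RN N → ℝ) (x : RN N) : ℝ := ∑ i, pd i (pd i u) x

/-- The unit cube, a fundamental domain for the torus `T^N` (of total measure `1`,
so that the measure on the torus is the normalized one). -/
def cube (N : ℕ) : Set (RN N) := Set.Icc 0 1

/-- The space-time cylinder `Q = T^N × (0,T)`. -/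
def QQ (N : ℕ) (T : ℝ) : Set (RN N × ℝ) := cube N ×ˢ Ioo 0 T

/-- Integral over `Q = T^N × (0,T)`. -/
def intQ (N : ℕ) (T : ℝ) (f : RN N → ℝ → ℝ) : ℝ := ∫ q in QQ N T, f q.1 q.2

/-- Smooth space-periodic test functions on `T^N × [0,T]`. -/
def IsTest (N : ℕ) (φ : RN N → ℝ → ℝ) : Prop :=
  ContDiff ℝ (⊤ : ℕ∞) (fun q : RN N × ℝ => φ q.1 q.2) ∧ ∀ t, ZPeriodic fun x => φ x t

/-- The Legendre transform `L(q) = sup_p (p·q - H(p))`. -/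
def Leg {N : ℕ} (H : RN N → ℝ) (q : RN N) : ℝ := sSup ((fun p => dotp p q - H p) '' Set.univ)

/-- `m L(-w/m)`, with the convention that it vanishes when `m ≤ 0` (recall that in `K`
one has `w = 0` a.e. on `{m = 0}`). -/
def mLag {N : ℕ} (L : RN N → ℝ) (mv : ℝ) (wv : RN N) : ℝ :=
  if 0 < mv then mv * L ((-mv⁻¹) • wv) else 0

/-- `|w|^{γ'} m^{1-γ'}`, with the convention that it vanishes when `m ≤ 0`. -/
def kinQ {N : ℕ} (γ' : ℝ) (mv : ℝ) (wv : RN N) : ℝ :=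
  if 0 < mv then euclNorm wv ^ γ' * mv ^ (1 - γ') else 0

/-- `F(x,m) = ∫_0^m f(x,σ) dσ`. -/
def Fint {N : ℕ} (f : RN N → ℝ → ℝ) (x : RN N) (mv : ℝ) : ℝ := ∫ σ in (0:ℝ)..mv, f x σ

/-- The convexifying term `G(x,t,m)`, as a function of `m̄(x,t)` (argument `mb`) and `m`. -/
def Gcvx (c_f α mb mv : ℝ) : ℝ :=
  ((c_f + 1) / (α * (α + 1))) * ((mv + 1) ^ (α + 1) - (mb + 1) ^ (α + 1))
    - ((c_f + 1) / α) * (mb + 1) ^ α * (mv - mb)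

/-- `g = ∂_m G`, as a function of `m̄(x,t)` (argument `mb`) and `m`. -/
def gcvx (c_f α mb mv : ℝ) : ℝ := ((c_f + 1) / α) * ((mv + 1) ^ α - (mb + 1) ^ α)

/-- The penalised Lagrangian `L_η(q) = L(q) + (η/(N+3)) |q|^{N+3}`. -/
def Lpen {N : ℕ} (L : RN N → ℝ) (η : ℝ) (q : RN N) : ℝ :=
  L q + (η / ((N : ℝ) + 3)) * euclNorm q ^ ((N : ℝ) + 3)

/-- The penalised Hamiltonian `H_η`, the Legendre transform of `L_η`. -/
def Hpen {N : ℕ} (L : RN N → ℝ) (η : ℝ) : RN N → ℝ := Leg (Lpen L η)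

/-- `g` is the weak spatial gradient of `m` on `Q`. -/
def HasWeakGradQ (N : ℕ) (T : ℝ) (m : RN N → ℝ → ℝ) (g : RN N → ℝ → RN N) : Prop :=
  ∀ Φ : RN N → ℝ → RN N, ContDiff ℝ (⊤ : ℕ∞) (fun q : RN N × ℝ => Φ q.1 q.2) →
    (∀ t, ZPeriodic fun x => Φ x t) →
    intQ N T (fun x t => m x t * dive (fun y => Φ y t) x)
      = -intQ N T (fun x t => dotp (g x t) (Φ x t))

/-- `m` is `θ`-Hölder continuous on `T^N × [0,T]` with constant `C`. -/
def HolderOnQ (N : ℕ) (T C θ : ℝ) (m : RN N → ℝ → ℝ) : Prop :=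
  ∀ x t x' t', t ∈ Icc (0:ℝ) T → t' ∈ Icc (0:ℝ) T →
    |m x t - m x' t'| ≤
      C * Real.sqrt (euclNorm (fun i => x i - x' i) ^ 2 + (t - t') ^ 2) ^ θ

/-- Membership in the constraint set `K`: `(m,w) ∈ L^{α+1}(Q) × L¹(Q;ℝ^N)`, `m ≥ 0`,
`|w|^{γ'} m^{1-γ'} ∈ L¹(Q)`, together with the weak Fokker–Planck constraint
(with initial datum `m₀`); the field `traceId` states that `m(·,T)` is the time-`T`
trace of `m` determined by the constraint. -/
structure MemK (N : ℕ) (T α γ' : ℝ) (m₀ : RN N → ℝ)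
    (m : RN N → ℝ → ℝ) (w : RN N → ℝ → RN N) : Prop where
  per_m : ∀ t, ZPeriodic fun x => m x t
  per_w : ∀ t, ZPeriodic fun x => w x t
  nonneg : ∀ x t, 0 ≤ m x t
  lp_m : IntegrableOn (fun q : RN N × ℝ => m q.1 q.2 ^ (α + 1)) (QQ N T)
  l1_w : IntegrableOn (fun q : RN N × ℝ => w q.1 q.2) (QQ N T)
  vanish : ∀ᵐ q ∂(volume.restrict (QQ N T)), m q.1 q.2 = 0 → w q.1 q.2 = 0
  kin_int : IntegrableOn (fun q : RN N × ℝ => kinQ γ' (m q.1 q.2) (w q.1 q.2)) (QQ N T)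
  traceInt : IntegrableOn (fun x => m x T) (cube N)
  fp : ∀ φ : RN N → ℝ → ℝ, IsTest N φ → (∀ x, φ x T = 0) →
    intQ N T (fun x t => m x t * deriv (φ x) t + dotp (w x t) (grad (fun y => φ y t) x)
        + m x t * lap (fun y => φ y t) x)
      + (∫ x in cube N, m₀ x * φ x 0) = 0
  traceId : ∀ φ : RN N → ℝ → ℝ, IsTest N φ →
    intQ N T (fun x t => m x t * deriv (φ x) t + dotp (w x t) (grad (fun y => φ y t) x)
        + m x t * lap (fun y => φ y t) x)
      + (∫ x in cube N, m₀ x * φ x 0) - (∫ x in cube N, m x T * φ x T) = 0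

/-- The energy functional `E` on `K`, with Lagrangian `L` and coupling antiderivative `F`. -/
def energyF (N : ℕ) (T : ℝ) (L : RN N → ℝ) (F : RN N → ℝ → ℝ) (uT : RN N → ℝ)
    (m : RN N → ℝ → ℝ) (w : RN N → ℝ → RN N) : ℝ :=
  intQ N T (fun x t => mLag L (m x t) (w x t) - F x (m x t)) + ∫ x in cube N, uT x * m x T

/-- `(m,w)` belongs to `K` and minimises the energy over `K`. -/
def MinimisesE (N : ℕ) (T α γ' : ℝ) (m₀ : RN N → ℝ) (L : RN N → ℝ) (F : RN N → ℝ → ℝ)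
    (uT : RN N → ℝ) (m : RN N → ℝ → ℝ) (w : RN N → ℝ → RN N) : Prop :=
  MemK N T α γ' m₀ m w ∧
    ∀ m' w', MemK N T α γ' m₀ m' w' → energyF N T L F uT m w ≤ energyF N T L F uT m' w'

/-- Classical solution of the MFG system `-∂_t u - Δu + H(∇u) = fc(x,t,m)`,
`∂_t m - Δm - div(∇H(∇u) m) = 0`, `m(·,0) = m₀`, `u(·,T) = u_T`:
`u, m` are continuous on `T^N × [0,T]` together with `∂_t u, ∂_t m` and all first and
second space derivatives, and the equations hold pointwise. -/
structure ClassicalSol (N : ℕ) (T : ℝ) (H : RN N → ℝ) (fc : RN N → ℝ → ℝ → ℝ)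
    (m₀ uT : RN N → ℝ) (u m : RN N → ℝ → ℝ) : Prop where
  per_u : ∀ t, ZPeriodic fun x => u x t
  per_m : ∀ t, ZPeriodic fun x => m x t
  cont_u : ContinuousOn (fun q : RN N × ℝ => u q.1 q.2) ((Set.univ : Set (RN N)) ×ˢ Icc 0 T)
  cont_m : ContinuousOn (fun q : RN N × ℝ => m q.1 q.2) ((Set.univ : Set (RN N)) ×ˢ Icc 0 T)
  cont_ut : ContinuousOn (fun q : RN N × ℝ => deriv (u q.1) q.2)
    ((Set.univ : Set (RN N)) ×ˢ Icc 0 T)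
  cont_mt : ContinuousOn (fun q : RN N × ℝ => deriv (m q.1) q.2)
    ((Set.univ : Set (RN N)) ×ˢ Icc 0 T)
  cont_du : ∀ i, ContinuousOn (fun q : RN N × ℝ => pd i (fun y => u y q.2) q.1)
    ((Set.univ : Set (RN N)) ×ˢ Icc 0 T)
  cont_dm : ∀ i, ContinuousOn (fun q : RN N × ℝ => pd i (fun y => m y q.2) q.1)
    ((Set.univ : Set (RN N)) ×ˢ Icc 0 T)
  cont_ddu : ∀ i j, ContinuousOn (fun q : RN N × ℝ => pd i (pd j fun y => u y q.2) q.1)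
    ((Set.univ : Set (RN N)) ×ˢ Icc 0 T)
  cont_ddm : ∀ i j, ContinuousOn (fun q : RN N × ℝ => pd i (pd j fun y => m y q.2) q.1)
    ((Set.univ : Set (RN N)) ×ˢ Icc 0 T)
  tdiff_u : ∀ x, ∀ t ∈ Ioo 0 T, DifferentiableAt ℝ (u x) t
  tdiff_m : ∀ x, ∀ t ∈ Ioo 0 T, DifferentiableAt ℝ (m x) t
  xdiff_u : ∀ t ∈ Icc 0 T,
    Differentiable ℝ (fun y => u y t) ∧ ∀ i, Differentiable ℝ (pd i fun y => u y t)
  xdiff_m : ∀ t ∈ Icc 0 T,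
    Differentiable ℝ (fun y => m y t) ∧ ∀ i, Differentiable ℝ (pd i fun y => m y t)
  hjb : ∀ x, ∀ t ∈ Ioo 0 T,
    -deriv (u x) t - lap (fun y => u y t) x + H (grad (fun y => u y t) x) = fc x t (m x t)
  fkp : ∀ x, ∀ t ∈ Ioo 0 T,
    deriv (m x) t - lap (fun y => m y t) x
      - dive (fun y => m y t • grad H (grad (fun z => u z t) y)) x = 0
  init : ∀ x, m x 0 = m₀ x
  final : ∀ x, u x T = uT x

/-- Weak solution `(u,m)` (with weak spatial gradient `Du` of `u`) of the MFG system
`-∂_t u - Δu + H(∇u) = fc(x,t,m)`, `∂_t m - Δm - div(∇H(∇u) m) = 0`, `m(·,0) = m₀`,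
`u(·,T) = u_T`, in the sense of Definition 3.1 of the paper. -/
structure WeakSol (N : ℕ) (T γ α : ℝ) (H : RN N → ℝ) (fc : RN N → ℝ → ℝ → ℝ)
    (m₀ uT : RN N → ℝ) (u m : RN N → ℝ → ℝ) (Du : RN N → ℝ → RN N) : Prop where
  per_u : ∀ t, ZPeriodic fun x => u x t
  per_m : ∀ t, ZPeriodic fun x => m x t
  per_Du : ∀ t, ZPeriodic fun x => Du x t
  nonneg_m : ∀ x t, 0 ≤ m x t
  lp_m : IntegrableOn (fun q : RN N × ℝ => m q.1 q.2 ^ (α + 1)) (QQ N T)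
  lq_u_sup : α < γ / N → ∃ C, ∀ᵐ q ∂(volume.restrict (QQ N T)), |u q.1 q.2| ≤ C
  lq_u_int : γ / N < α →
    IntegrableOn (fun q : RN N × ℝ =>
      |u q.1 q.2| ^ (γ * (α + 1) * (1 + (N : ℝ)) / (α * N - γ))) (QQ N T)
  weak_grad : HasWeakGradQ N T u Du
  lγ_Du : IntegrableOn (fun q : RN N × ℝ => euclNorm (Du q.1 q.2) ^ γ) (QQ N T)
  int_mL : IntegrableOn (fun q : RN N × ℝ =>
      m q.1 q.2 * Leg H (grad H (Du q.1 q.2))) (QQ N T)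
  int_mDH : IntegrableOn (fun q : RN N × ℝ => m q.1 q.2 • grad H (Du q.1 q.2)) (QQ N T)
  hjb : ∀ φ : RN N → ℝ → ℝ, IsTest N φ → (∀ x t, 0 ≤ φ x t) →
    (∃ ε > (0:ℝ), ∀ x, ∀ t ≤ ε, φ x t = 0) →
    intQ N T (fun x t => u x t * deriv (φ x) t - u x t * lap (fun y => φ y t) x
        + (H (Du x t) - fc x t (m x t)) * φ x t)
      ≤ ∫ x in cube N, uT x * φ x T
  fkp : ∀ φ : RN N → ℝ → ℝ, IsTest N φ → (∀ x, φ x T = 0) →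
    intQ N T (fun x t => m x t * deriv (φ x) t
        - dotp (m x t • grad H (Du x t)) (grad (fun y => φ y t) x)
        + m x t * lap (fun y => φ y t) x)
      + (∫ x in cube N, m₀ x * φ x 0) = 0
  energy_id : intQ N T (fun x t =>
        m x t * (-(fc x t (m x t)) + Leg H (grad H (Du x t))))
      + (∫ x in cube N, (m x T * uT x - m₀ x * u x 0)) = 0

/-- Nonnegative weak solution of the Fokker–Planck equation
`∂_t m - Δm + div(A m) = 0` in `Q`, `m(·,0) = m₀`, with finite energy
`E = ∫_Q |A|^{γ'} m < ∞`. -/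
structure FPSol (N : ℕ) (T γ' : ℝ) (m₀ : RN N → ℝ) (m : RN N → ℝ → ℝ)
    (A : RN N → ℝ → RN N) : Prop where
  per_m : ∀ t, ZPeriodic fun x => m x t
  per_A : ∀ t, ZPeriodic fun x => A x t
  nonneg : ∀ x t, 0 ≤ m x t
  int_m : IntegrableOn (fun q : RN N × ℝ => m q.1 q.2) (QQ N T)
  int_E : IntegrableOn (fun q : RN N × ℝ => euclNorm (A q.1 q.2) ^ γ' * m q.1 q.2) (QQ N T)
  weak : ∀ φ : RN N → ℝ → ℝ, IsTest N φ → (∀ x, φ x T = 0) →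
    intQ N T (fun x t => m x t * (deriv (φ x) t + lap (fun y => φ y t) x
        + dotp (A x t) (grad (fun y => φ y t) x)))
      + (∫ x in cube N, m₀ x * φ x 0) = 0

/-- Conditions on the initial datum of the Fokker–Planck equation: a periodic (i.e.
defined on the torus) Lipschitz probability density, with `‖∇m₀‖_∞ ≤ K₀`. -/
def FPData (N : ℕ) (K₀ : ℝ) (m₀ : RN N → ℝ) : Prop :=
  ZPeriodic m₀ ∧ (∀ x, 0 ≤ m₀ x) ∧ (∫ x in cube N, m₀ x) = 1 ∧
    Differentiable ℝ m₀ ∧ ∀ x, euclNorm (grad m₀ x) ≤ K₀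

/-- The squared periodic distance `sin²(πz)/π²` on the circle. -/
def circleSq (z : ℝ) : ℝ := Real.sin (Real.pi * z) ^ 2 / Real.pi ^ 2

/-- The squared periodic distance on the torus. -/
def torusSq {N : ℕ} (z : RN N) : ℝ := ∑ i, circleSq (z i)

/-- A Gaussian-type profile on the torus with spatial scale `√τ`. -/
def profile {N : ℕ} (z : RN N) (τ : ℝ) : ℝ :=
  τ ^ (-((N : ℝ) / 2)) * Real.exp (-(torusSq z) / (8 * τ))

lemma circleSq_nonneg (z : ℝ) : 0 ≤ circleSq z := by unfold circleSq; positivity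

lemma torusSq_nonneg {N : ℕ} (z : RN N) : 0 ≤ torusSq z :=
  Finset.sum_nonneg fun i _ => circleSq_nonneg (z i)

lemma circleSq_neg (z : ℝ) : circleSq (-z) = circleSq z := by
  simp [circleSq, Real.sin_neg]

lemma torusSq_sub_comm {N : ℕ} (x y : RN N) : torusSq (x - y) = torusSq (y - x) := by
  unfold torusSq
  refine Finset.sum_congr rfl fun i _ => ?_
  rw [← circleSq_neg]
  congr 1
  simp

lemma continuous_circleSq : Continuous circleSq := by unfold circleSq; fun_prop

lemma continuous_torusSq {N : ℕ} : Continuous (torusSq (N := N)) := by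
  unfold torusSq
  exact continuous_finsetSum _ fun i _ => continuous_circleSq.comp (continuous_apply i)

lemma profile_nonneg {N : ℕ} (z : RN N) {τ : ℝ} (hτ : 0 < τ) : 0 ≤ profile z τ := by
  unfold profile; positivity

lemma profile_pos {N : ℕ} (z : RN N) {τ : ℝ} (hτ : 0 < τ) : 0 < profile z τ := by
  unfold profile; positivity

lemma profile_le {N : ℕ} (z : RN N) {τ : ℝ} (hτ : 0 < τ) :
    profile z τ ≤ τ ^ (-((N : ℝ) / 2)) := by
  unfold profile
  have h : Real.exp (-(torusSq z) / (8 * τ)) ≤ 1 := by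
    rw [Real.exp_le_one_iff]
    exact div_nonpos_of_nonpos_of_nonneg (neg_nonpos.2 (torusSq_nonneg z)) (by positivity)
  exact mul_le_of_le_one_right (by positivity) h

lemma profile_sub_comm {N : ℕ} (x y : RN N) (τ : ℝ) : profile (x - y) τ = profile (y - x) τ := by
  unfold profile; rw [torusSq_sub_comm]

lemma circleSq_ge_of_abs_le_half {z : ℝ} (hz : |z| ≤ 1 / 2) :
    4 / Real.pi ^ 2 * z ^ 2 ≤ circleSq z := by
  have hπ := Real.pi_pos
  have h1 : 2 / Real.pi * (Real.pi * |z|) ≤ Real.sin (Real.pi * |z|) :=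
    Real.mul_le_sin (by positivity) (by nlinarith)
  have h2 : 2 / Real.pi * (Real.pi * |z|) = 2 * |z| := by field_simp
  have h3 : Real.sin (Real.pi * |z|) ^ 2 = Real.sin (Real.pi * z) ^ 2 := by
    rcases abs_cases z with ⟨h, _⟩ | ⟨h, _⟩ <;> rw [h]
    rw [mul_neg, Real.sin_neg, neg_sq]
  unfold circleSq
  rw [← h3, div_mul_eq_mul_div]
  gcongr
  rw [h2] at h1
  have := abs_nonneg z
  calc 4 * z ^ 2 = (2 * |z|) ^ 2 := by rw [mul_pow, sq_abs]; ring
    _ ≤ _ := by gcongr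

lemma circleSq_sub_one (z : ℝ) : circleSq (z - 1) = circleSq z := by
  unfold circleSq
  rw [mul_sub, mul_one, Real.sin_sub_pi, neg_sq]

lemma exp_circleSq_le {z τ : ℝ} (hτ : 0 < τ) (hz : |z| ≤ 1) :
    Real.exp (-circleSq z / (8 * τ)) ≤ Real.exp (-(1 / (2 * Real.pi ^ 2 * τ)) * z ^ 2)
      + Real.exp (-(1 / (2 * Real.pi ^ 2 * τ)) * (z - 1) ^ 2)
      + Real.exp (-(1 / (2 * Real.pi ^ 2 * τ)) * (z + 1) ^ 2) := by
  have key : ∀ w, 4 / Real.pi ^ 2 * w ^ 2 ≤ circleSq z →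
      Real.exp (-circleSq z / (8 * τ)) ≤ Real.exp (-(1 / (2 * Real.pi ^ 2 * τ)) * w ^ 2) := by
    intro w hw
    apply Real.exp_le_exp.2
    rw [div_le_iff₀ (by positivity)]
    have : -(1 / (2 * Real.pi ^ 2 * τ)) * w ^ 2 * (8 * τ) = -(4 / Real.pi ^ 2 * w ^ 2) := by
      have := Real.pi_pos
      field_simp
      ring
    linarith
  rw [abs_le] at hz
  have e1 := Real.exp_pos (-(1 / (2 * Real.pi ^ 2 * τ)) * z ^ 2)
  have e2 := Real.exp_pos (-(1 / (2 * Real.pi ^ 2 * τ)) * (z - 1) ^ 2)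
  have e3 := Real.exp_pos (-(1 / (2 * Real.pi ^ 2 * τ)) * (z + 1) ^ 2)
  by_cases h1 : z ≤ -(1 / 2)
  · have := key (z + 1) (by
      have := circleSq_ge_of_abs_le_half (z := z + 1) (by rw [abs_le]; constructor <;> linarith)
      have h := circleSq_sub_one (z + 1)
      rw [add_sub_cancel_right] at h
      linarith)
    linarith
  by_cases h2 : 1 / 2 ≤ z
  · have := key (z - 1) (by
      have := circleSq_ge_of_abs_le_half (z := z - 1) (by rw [abs_le]; constructor <;> linarith)
      have h := circleSq_sub_one z
      linarith)
    linarith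
  have := key z (circleSq_ge_of_abs_le_half (by rw [abs_le]; constructor <;> linarith))
  linarith

lemma integral_exp_circleSq_le {x τ : ℝ} (hx : x ∈ Icc (0 : ℝ) 1) (hτ : 0 < τ) :
    ∫ y in Icc (0 : ℝ) 1, τ ^ (-(1 / 2 : ℝ)) * Real.exp (-circleSq (x - y) / (8 * τ))
      ≤ 3 * √(2 * Real.pi ^ 3) := by
  have hπ := Real.pi_pos
  set b := 1 / (2 * Real.pi ^ 2 * τ) with hb
  have hb0 : 0 < b := by positivity
  have hg : ∀ c : ℝ, Integrable (fun y : ℝ => Real.exp (-b * (c - y) ^ 2)) := fun c =>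
    (integrable_exp_neg_mul_sq hb0).comp_sub_left c
  have hgi : ∀ c : ℝ, ∫ y : ℝ, Real.exp (-b * (c - y) ^ 2) = √(Real.pi / b) := by
    intro c
    rw [← integral_gaussian b]
    exact integral_sub_left_eq_self (fun y => Real.exp (-b * y ^ 2)) volume c
  have hG : Integrable (fun y : ℝ => Real.exp (-b * (x - y) ^ 2) + Real.exp (-b * ((x - 1) - y) ^ 2)
      + Real.exp (-b * ((x + 1) - y) ^ 2)) := ((hg x).add (hg (x - 1))).add (hg (x + 1))
  rw [integral_const_mul]
  have h1 : ∫ y in Icc (0 : ℝ) 1, Real.exp (-circleSq (x - y) / (8 * τ))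
      ≤ ∫ y in Icc (0 : ℝ) 1, (Real.exp (-b * (x - y) ^ 2) + Real.exp (-b * ((x - 1) - y) ^ 2)
      + Real.exp (-b * ((x + 1) - y) ^ 2)) := by
    apply setIntegral_mono_on _ hG.integrableOn measurableSet_Icc
    · intro y hy
      have := exp_circleSq_le (z := x - y) hτ (by
        rw [abs_le]; constructor <;> linarith [hx.1, hx.2, hy.1, hy.2])
      rw [← hb] at this
      have e1 : x - 1 - y = x - y - 1 := by ring
      have e2 : x + 1 - y = x - y + 1 := by ring
      simpa only [e1, e2] using this
    · apply Continuous.integrableOn_Icc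
      have := continuous_circleSq
      fun_prop
  have h2 : ∫ y in Icc (0 : ℝ) 1, (Real.exp (-b * (x - y) ^ 2) + Real.exp (-b * ((x - 1) - y) ^ 2)
      + Real.exp (-b * ((x + 1) - y) ^ 2)) ≤ 3 * √(Real.pi / b) := by
    refine (setIntegral_le_integral hG (Eventually.of_forall fun y => by positivity)).trans ?_
    have e := integral_add ((hg x).add (hg (x - 1))) (hg (x + 1))
    have e' := integral_add (hg x) (hg (x - 1))
    simp only [Pi.add_apply] at e
    rw [e, e', hgi, hgi, hgi]
    linarith
  have h3 : √(Real.pi / b) = √(2 * Real.pi ^ 3) * √τ := by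
    rw [← Real.sqrt_mul (by positivity)]
    congr 1
    rw [hb]; field_simp
  have h4 : τ ^ (-(1 / 2 : ℝ)) * √τ = 1 := by
    rw [Real.sqrt_eq_rpow, ← Real.rpow_add hτ]; norm_num
  calc _ ≤ τ ^ (-(1 / 2 : ℝ)) * (3 * √(Real.pi / b)) := by
        gcongr; exact h1.trans h2
    _ = 3 * √(2 * Real.pi ^ 3) * (τ ^ (-(1 / 2 : ℝ)) * √τ) := by rw [h3]; ring
    _ = _ := by rw [h4, mul_one]

lemma profile_eq_prod {N : ℕ} (z : RN N) {τ : ℝ} (hτ : 0 < τ) :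
    profile z τ = ∏ i, τ ^ (-(1 / 2 : ℝ)) * Real.exp (-circleSq (z i) / (8 * τ)) := by
  rw [Finset.prod_mul_distrib, Finset.prod_const, ← Real.exp_sum, Finset.card_univ,
    Fintype.card_fin, ← Real.rpow_natCast, ← Real.rpow_mul hτ.le]
  unfold profile torusSq
  congr 2
  · ring
  · rw [← Finset.sum_neg_distrib, Finset.sum_div]

/-- A bound for the mass of `profile` on the torus. -/
def profileMass (N : ℕ) : ℝ := (3 * √(2 * Real.pi ^ 3)) ^ N

lemma volume_restrict_cube (N : ℕ) :
    (volume : Measure (RN N)).restrict (cube N)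
      = Measure.pi fun _ : Fin N => (volume : Measure ℝ).restrict (Icc 0 1) := by
  rw [← Measure.restrict_pi_pi, volume_pi]
  congr 1
  exact (pi_univ_Icc 0 1).symm

lemma lintegral_profile_le {N : ℕ} {x : RN N} (hx : x ∈ cube N) {τ : ℝ} (hτ : 0 < τ) :
    ∫⁻ y in cube N, ENNReal.ofReal (profile (x - y) τ) ≤ ENNReal.ofReal (profileMass N) := by
  have hx' : ∀ i, x i ∈ Icc (0 : ℝ) 1 := fun i => ⟨hx.1 i, hx.2 i⟩
  have hinteg : ∀ i, Integrable (fun y : ℝ => τ ^ (-(1 / 2 : ℝ)) *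
      Real.exp (-circleSq (x i - y) / (8 * τ))) (volume.restrict (Icc 0 1)) := by
    intro i
    apply Continuous.integrableOn_Icc
    have := continuous_circleSq
    fun_prop
  have hfe : ∀ y : RN N, profile (x - y) τ = ∏ i, τ ^ (-(1 / 2 : ℝ)) *
      Real.exp (-circleSq (x i - y i) / (8 * τ)) := fun y => profile_eq_prod _ hτ
  rw [volume_restrict_cube, ← ofReal_integral_eq_lintegral_ofReal]
  · apply ENNReal.ofReal_le_ofReal
    simp_rw [hfe]
    rw [integral_fintype_prod_eq_prod (𝕜 := ℝ) (fun i (y : ℝ) => τ ^ (-(1 / 2 : ℝ)) *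
      Real.exp (-circleSq (x i - y) / (8 * τ)))]
    unfold profileMass
    calc _ ≤ ∏ _i : Fin N, (3 * √(2 * Real.pi ^ 3)) := by
          refine Finset.prod_le_prod (fun i _ => integral_nonneg fun y => by positivity) ?_
          exact fun i _ => integral_exp_circleSq_le (hx' i) hτ
      _ = _ := by simp
  · simp_rw [hfe]
    exact Integrable.fintype_prod hinteg
  · exact Eventually.of_forall fun y => profile_nonneg _ hτ

lemma lintegral_rpow_lt_top (T : ℝ) {c : ℝ} (hc : c < 1) :
    ∫⁻ τ : ℝ, (Ioo 0 T).indicator (fun τ => ENNReal.ofReal (τ ^ (-c))) τ < ⊤ := by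
  rw [lintegral_indicator measurableSet_Ioo]
  rcases le_or_gt T 0 with h | h
  · simp [Ioo_eq_empty_of_le h]
  have h1 : IntegrableOn (fun τ : ℝ => τ ^ (-c)) (Ioo 0 T) := by
    have := intervalIntegral.intervalIntegrable_rpow' (a := 0) (b := T) (r := -c) (by linarith)
    rw [intervalIntegrable_iff_integrableOn_Ioo_of_le h.le] at this
    exact this
  rw [← ofReal_integral_eq_lintegral_ofReal h1]
  · exact ENNReal.ofReal_lt_top
  · filter_upwards [ae_restrict_mem measurableSet_Ioo] with τ hτ
    exact Real.rpow_nonneg hτ.1.le _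

/-- Lebesgue measure on the space-time cylinder. -/
abbrev cylMeasure (N : ℕ) (T : ℝ) : Measure (RN N × ℝ) := volume.restrict (QQ N T)

lemma cylMeasure_eq_prod (N : ℕ) (T : ℝ) :
    cylMeasure N T = ((volume : Measure (RN N)).restrict (cube N)).prod
      ((volume : Measure ℝ).restrict (Ioo 0 T)) := by
  rw [Measure.prod_restrict]; rfl

lemma measurableSet_cube (N : ℕ) : MeasurableSet (cube N) := measurableSet_Icc

lemma measurableSet_QQ (N : ℕ) (T : ℝ) : MeasurableSet (QQ N T) :=
  (measurableSet_cube N).prod measurableSet_Ioo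

lemma volume_cube (N : ℕ) : volume (cube N) = 1 := by
  unfold cube
  rw [Real.volume_Icc_pi]
  simp

lemma cylMeasure_univ (N : ℕ) (T : ℝ) : cylMeasure N T univ = ENNReal.ofReal T := by
  rw [cylMeasure_eq_prod, ← univ_prod_univ, Measure.prod_prod]
  simp [volume_cube]

instance (N : ℕ) (T : ℝ) : IsFiniteMeasure (cylMeasure N T) :=
  ⟨by rw [cylMeasure_univ]; exact ENNReal.ofReal_lt_top⟩

lemma lintegral_cylMeasure {N : ℕ} {T : ℝ} {f : RN N × ℝ → ENNReal} (hf : Measurable f) :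
    ∫⁻ q, f q ∂(cylMeasure N T) = ∫⁻ t in Ioo 0 T, ∫⁻ x in cube N, f (x, t) := by
  rw [cylMeasure_eq_prod, lintegral_prod_symm _ hf.aemeasurable]

/-- The singular space-time kernel `τ^{-a} G_τ` on `{0 < τ < T}`, where `G` is `profile`. -/
def heatKer {N : ℕ} (T a : ℝ) (q q' : RN N × ℝ) : ENNReal :=
  (Ioo 0 T).indicator (fun τ => ENNReal.ofReal (τ ^ (-a) * profile (q.1 - q'.1) τ)) (q.2 - q'.2)

lemma measurable_profile {N : ℕ} : Measurable fun p : RN N × ℝ => profile p.1 p.2 := by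
  unfold profile
  have := (continuous_torusSq (N := N)).measurable
  fun_prop

lemma measurable_heatKer {N : ℕ} (T a : ℝ) :
    Measurable fun p : (RN N × ℝ) × (RN N × ℝ) => heatKer T a p.1 p.2 := by
  unfold heatKer
  have h : Measurable fun p : RN N × ℝ =>
      ((Ioo (0:ℝ) T).indicator (fun τ => ENNReal.ofReal (τ ^ (-a) * profile p.1 τ)) p.2) := by
    have h1 : Measurable fun p : RN N × ℝ => ENNReal.ofReal (p.2 ^ (-a) * profile p.1 p.2) := by
      have := measurable_profile (N := N)
      fun_prop
    have h2 : MeasurableSet {p : RN N × ℝ | p.2 ∈ Ioo 0 T} := measurable_snd measurableSet_Ioo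
    exact h1.indicator h2
  exact h.comp (g := fun p : RN N × ℝ => _)
    (f := fun p : (RN N × ℝ) × (RN N × ℝ) => (p.1.1 - p.2.1, p.1.2 - p.2.2)) (by fun_prop)

lemma measurable_heatKer_right {N : ℕ} (T a : ℝ) (q : RN N × ℝ) :
    Measurable fun q' => heatKer T a q q' :=
  Measurable.of_uncurry_left (f := heatKer T a) (measurable_heatKer T a)

lemma measurable_heatKer_left {N : ℕ} (T a : ℝ) (q' : RN N × ℝ) :
    Measurable fun q => heatKer T a q q' :=
  Measurable.of_uncurry_right (f := heatKer T a) (measurable_heatKer T a)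

lemma lintegral_profile_mul_rpow_le {N : ℕ} {x : RN N} (hx : x ∈ cube N) {τ lam : ℝ} (hτ : 0 < τ)
    (h0 : 0 ≤ lam) (h1 : lam ≤ 1) {g : RN N → ENNReal} (hg : Measurable g)
    (hg1 : ∫⁻ y in cube N, g y ≤ 1) :
    ∫⁻ y in cube N, ENNReal.ofReal (profile (x - y) τ) * g y ^ lam
      ≤ ENNReal.ofReal (profileMass N) ^ (1 - lam) * ENNReal.ofReal (τ ^ (-(lam * N / 2))) := by
  have hm : Measurable fun y => ENNReal.ofReal (profile (x - y) τ) := by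
    have := (measurable_profile (N := N)).comp (f := fun y => (x - y, τ)) (by fun_prop)
    exact ENNReal.measurable_ofReal.comp this
  calc ∫⁻ y in cube N, ENNReal.ofReal (profile (x - y) τ) * g y ^ lam
      = ∫⁻ y in cube N, ENNReal.ofReal (profile (x - y) τ) ^ (1 - lam) *
          (ENNReal.ofReal (profile (x - y) τ) * g y) ^ lam := by
        refine lintegral_congr fun y => ?_
        rw [ENNReal.mul_rpow_of_nonneg _ _ h0, ← mul_assoc,
          ← ENNReal.rpow_add_of_nonneg _ _ (by linarith) h0, sub_add_cancel, ENNReal.rpow_one]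
    _ ≤ (∫⁻ y in cube N, ENNReal.ofReal (profile (x - y) τ)) ^ (1 - lam) *
          (∫⁻ y in cube N, ENNReal.ofReal (profile (x - y) τ) * g y) ^ lam :=
        ENNReal.lintegral_mul_norm_pow_le hm.aemeasurable (hm.mul hg).aemeasurable
          (by linarith) h0 (by ring)
    _ ≤ ENNReal.ofReal (profileMass N) ^ (1 - lam) *
          (ENNReal.ofReal (τ ^ (-((N : ℝ) / 2)))) ^ lam := by
        gcongr
        · exact lintegral_profile_le hx hτ
        · calc _ ≤ ∫⁻ y in cube N, ENNReal.ofReal (τ ^ (-((N : ℝ) / 2))) * g y := by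
                gcongr with y
                exact profile_le _ hτ
            _ = ENNReal.ofReal (τ ^ (-((N : ℝ) / 2))) * ∫⁻ y in cube N, g y :=
                lintegral_const_mul _ hg
            _ ≤ _ := mul_le_of_le_one_right' hg1
    _ = _ := by
        rw [ENNReal.ofReal_rpow_of_pos (x := τ ^ _) (by positivity), ← Real.rpow_mul hτ.le]
        congr 3
        ring

/-- The constant in the bounds for `heatKer` against powers of densities. -/
def heatKerConst (N : ℕ) (T a lam : ℝ) : ENNReal :=
  ENNReal.ofReal (profileMass N) ^ (1 - lam) *
    ∫⁻ τ : ℝ, (Ioo 0 T).indicator (fun τ => ENNReal.ofReal (τ ^ (-(a + lam * N / 2)))) τ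

lemma heatKerConst_lt_top {N : ℕ} {T a lam : ℝ} (h1 : lam ≤ 1) (ha : a + lam * N / 2 < 1) :
    heatKerConst N T a lam < ⊤ :=
  ENNReal.mul_lt_top (ENNReal.rpow_lt_top_of_nonneg (by linarith) ENNReal.ofReal_ne_top)
    (lintegral_rpow_lt_top T ha)

lemma indicator_slice_le {N : ℕ} {T a lam τ : ℝ} {x : RN N} (hx : x ∈ cube N)
    (h0 : 0 ≤ lam) (h1 : lam ≤ 1) {g : RN N → ENNReal} (hg : Measurable g)
    (hg1 : ∫⁻ y in cube N, g y ≤ 1) :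
    ∫⁻ y in cube N, (Ioo 0 T).indicator
        (fun τ => ENNReal.ofReal (τ ^ (-a) * profile (x - y) τ)) τ * g y ^ lam
      ≤ ENNReal.ofReal (profileMass N) ^ (1 - lam) *
        (Ioo 0 T).indicator (fun τ => ENNReal.ofReal (τ ^ (-(a + lam * N / 2)))) τ := by
  by_cases hτ : τ ∈ Ioo 0 T
  · simp only [indicator_of_mem hτ]
    have hτ0 : 0 < τ := hτ.1
    calc _ = ∫⁻ y in cube N, ENNReal.ofReal (τ ^ (-a)) *
          (ENNReal.ofReal (profile (x - y) τ) * g y ^ lam) := by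
          refine lintegral_congr fun y => ?_
          rw [ENNReal.ofReal_mul (by positivity), mul_assoc]
      _ = ENNReal.ofReal (τ ^ (-a)) * ∫⁻ y in cube N,
          (ENNReal.ofReal (profile (x - y) τ) * g y ^ lam) :=
          lintegral_const_mul' _ _ ENNReal.ofReal_ne_top
      _ ≤ ENNReal.ofReal (τ ^ (-a)) * (ENNReal.ofReal (profileMass N) ^ (1 - lam) *
          ENNReal.ofReal (τ ^ (-(lam * N / 2)))) := by
          gcongr
          exact lintegral_profile_mul_rpow_le hx hτ0 h0 h1 hg hg1
      _ = _ := by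
          rw [mul_left_comm, ← ENNReal.ofReal_mul (by positivity), ← Real.rpow_add hτ0]
          congr 3
          ring
  · simp [indicator_of_notMem hτ]

lemma lintegral_heatKer_right_le {N : ℕ} {T a lam : ℝ} (h0 : 0 ≤ lam) (h1 : lam ≤ 1)
    {M : RN N × ℝ → ENNReal} (hM : Measurable M)
    (hM1 : ∀ᵐ t ∂(volume.restrict (Ioo 0 T)), ∫⁻ y in cube N, M (y, t) ≤ 1)
    {q : RN N × ℝ} (hq : q ∈ QQ N T) :
    ∫⁻ q', heatKer T a q q' * M q' ^ lam ∂(cylMeasure N T) ≤ heatKerConst N T a lam := by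
  rw [lintegral_cylMeasure (f := fun q' => heatKer T a q q' * M q' ^ lam)
    ((measurable_heatKer_right T a q).mul (hM.pow_const lam))]
  have hmeas : Measurable fun τ : ℝ =>
      (Ioo 0 T).indicator (fun τ => ENNReal.ofReal (τ ^ (-(a + lam * N / 2)))) τ :=
    Measurable.indicator (by fun_prop) measurableSet_Ioo
  calc _ ≤ ∫⁻ s in Ioo 0 T, ENNReal.ofReal (profileMass N) ^ (1 - lam) *
        (Ioo 0 T).indicator (fun τ => ENNReal.ofReal (τ ^ (-(a + lam * N / 2)))) (q.2 - s) := by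
        refine lintegral_mono_ae ?_
        filter_upwards [hM1] with s hs
        exact indicator_slice_le hq.1 h0 h1 (hM.comp measurable_prodMk_right) hs
    _ ≤ ∫⁻ s, ENNReal.ofReal (profileMass N) ^ (1 - lam) *
        (Ioo 0 T).indicator (fun τ => ENNReal.ofReal (τ ^ (-(a + lam * N / 2)))) (q.2 - s) :=
        setLIntegral_le_lintegral _ _
    _ = heatKerConst N T a lam := by
        rw [lintegral_sub_left_eq_self (fun τ => ENNReal.ofReal (profileMass N) ^ (1 - lam) *
          (Ioo 0 T).indicator (fun τ => ENNReal.ofReal (τ ^ (-(a + lam * N / 2)))) τ) q.2,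
          lintegral_const_mul _ hmeas]
        rfl

lemma lintegral_heatKer_left_le {N : ℕ} {T a lam : ℝ} (h0 : 0 ≤ lam) (h1 : lam ≤ 1)
    {M : RN N × ℝ → ENNReal} (hM : Measurable M)
    (hM1 : ∀ᵐ t ∂(volume.restrict (Ioo 0 T)), ∫⁻ y in cube N, M (y, t) ≤ 1)
    {q' : RN N × ℝ} (hq : q' ∈ QQ N T) :
    ∫⁻ q, heatKer T a q q' * M q ^ lam ∂(cylMeasure N T) ≤ heatKerConst N T a lam := by
  rw [lintegral_cylMeasure (f := fun q => heatKer T a q q' * M q ^ lam)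
    ((measurable_heatKer_left T a q').mul (hM.pow_const lam))]
  have hmeas : Measurable fun τ : ℝ =>
      (Ioo 0 T).indicator (fun τ => ENNReal.ofReal (τ ^ (-(a + lam * N / 2)))) τ :=
    Measurable.indicator (by fun_prop) measurableSet_Ioo
  calc _ ≤ ∫⁻ s in Ioo 0 T, ENNReal.ofReal (profileMass N) ^ (1 - lam) *
        (Ioo 0 T).indicator (fun τ => ENNReal.ofReal (τ ^ (-(a + lam * N / 2)))) (s - q'.2) := by
        refine lintegral_mono_ae ?_
        filter_upwards [hM1] with s hs
        unfold heatKer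
        simp_rw [fun y => profile_sub_comm y q'.1]
        exact indicator_slice_le hq.1 h0 h1 (hM.comp measurable_prodMk_right) hs
    _ ≤ ∫⁻ s, ENNReal.ofReal (profileMass N) ^ (1 - lam) *
        (Ioo 0 T).indicator (fun τ => ENNReal.ofReal (τ ^ (-(a + lam * N / 2)))) (s - q'.2) :=
        setLIntegral_le_lintegral _ _
    _ = heatKerConst N T a lam := by
        rw [lintegral_sub_right_eq_self (fun τ => ENNReal.ofReal (profileMass N) ^ (1 - lam) *
          (Ioo 0 T).indicator (fun τ => ENNReal.ofReal (τ ^ (-(a + lam * N / 2)))) τ) q'.2,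
          lintegral_const_mul _ hmeas]
        rfl

/-- The integral operator with kernel `heatKer`. -/
def heatOp {N : ℕ} (T a : ℝ) (f : RN N × ℝ → ENNReal) (q : RN N × ℝ) : ENNReal :=
  ∫⁻ q', heatKer T a q q' * f q' ∂(cylMeasure N T)

lemma measurable_heatOp {N : ℕ} (T a : ℝ) {f : RN N × ℝ → ENNReal} (hf : Measurable f) :
    Measurable (heatOp T a f) :=
  Measurable.lintegral_prod_right ((measurable_heatKer T a).mul (hf.comp measurable_snd))

lemma heatOp_rpow_le {N : ℕ} {T a lam : ℝ} (h0 : 0 ≤ lam) (h1 : lam ≤ 1)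
    {M : RN N × ℝ → ENNReal} (hM : Measurable M)
    (hM1 : ∀ᵐ t ∂(volume.restrict (Ioo 0 T)), ∫⁻ y in cube N, M (y, t) ≤ 1)
    {q : RN N × ℝ} (hq : q ∈ QQ N T) :
    heatOp T a (fun q' => M q' ^ lam) q ≤ heatKerConst N T a lam :=
  lintegral_heatKer_right_le h0 h1 hM hM1 hq

lemma lintegral_rpow_mul_heatOp_le {N : ℕ} {T a lam : ℝ} (h0 : 0 ≤ lam) (h1 : lam ≤ 1)
    {M f : RN N × ℝ → ENNReal} (hM : Measurable M) (hf : Measurable f)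
    (hM1 : ∀ᵐ t ∂(volume.restrict (Ioo 0 T)), ∫⁻ y in cube N, M (y, t) ≤ 1) :
    ∫⁻ q, M q ^ lam * heatOp T a f q ∂(cylMeasure N T)
      ≤ heatKerConst N T a lam * ∫⁻ q, f q ∂(cylMeasure N T) := by
  have hk := measurable_heatKer (N := N) T a
  calc _ = ∫⁻ q, ∫⁻ q', M q ^ lam * (heatKer T a q q' * f q') ∂(cylMeasure N T)
        ∂(cylMeasure N T) := by
        refine lintegral_congr fun q => ?_
        exact (lintegral_const_mul _ ((measurable_heatKer_right T a q).mul hf)).symm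
    _ = ∫⁻ q', ∫⁻ q, M q ^ lam * (heatKer T a q q' * f q') ∂(cylMeasure N T)
        ∂(cylMeasure N T) := by
        apply lintegral_lintegral_swap
        apply Measurable.aemeasurable
        have e : (Function.uncurry fun q q' => M q ^ lam * (heatKer T a q q' * f q'))
            = fun p : (RN N × ℝ) × (RN N × ℝ) =>
              M p.1 ^ lam * (heatKer T a p.1 p.2 * f p.2) := rfl
        rw [e]
        fun_prop
    _ ≤ ∫⁻ q', heatKerConst N T a lam * f q' ∂(cylMeasure N T) := by
        refine lintegral_mono_ae ?_
        filter_upwards [ae_restrict_mem (measurableSet_QQ N T)] with q' hq'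
        calc _ = ∫⁻ q, heatKer T a q q' * M q ^ lam * f q' ∂(cylMeasure N T) := by
              refine lintegral_congr fun q => by ring
          _ = (∫⁻ q, heatKer T a q q' * M q ^ lam ∂(cylMeasure N T)) * f q' :=
              lintegral_mul_const _ ((measurable_heatKer_left T a q').mul (hM.pow_const _))
          _ ≤ _ := by gcongr; exact lintegral_heatKer_left_le h0 h1 hM hM1 hq'
    _ = _ := lintegral_const_mul _ hf

lemma lintegral_heatOp_le {N : ℕ} {T a : ℝ} {f : RN N × ℝ → ENNReal} (hf : Measurable f) :
    ∫⁻ q, heatOp T a f q ∂(cylMeasure N T)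
      ≤ heatKerConst N T a 0 * ∫⁻ q, f q ∂(cylMeasure N T) := by
  simpa using lintegral_rpow_mul_heatOp_le (M := fun _ => 0) (lam := 0) (a := a) (T := T) le_rfl
    zero_le_one measurable_const hf (by simp)

lemma lintegral_rpow_mul_rpow_mul_rpow_le {X : Type*} [MeasurableSpace X] {μ : Measure X}
    {f g h : X → ENNReal} (hf : AEMeasurable f μ) (hg : AEMeasurable g μ) (hh : AEMeasurable h μ)
    {u v w : ℝ} (hu : 0 ≤ u) (hv : 0 ≤ v) (hw : 0 ≤ w) (hs : u + v + w = 1) :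
    ∫⁻ x, f x ^ u * g x ^ v * h x ^ w ∂μ
      ≤ (∫⁻ x, f x ∂μ) ^ u * (∫⁻ x, g x ∂μ) ^ v * (∫⁻ x, h x ∂μ) ^ w := by
  have := ENNReal.lintegral_prod_norm_pow_le (μ := μ) (Finset.univ : Finset (Fin 3))
    (f := ![f, g, h]) (by intro i _; fin_cases i <;> simpa) (p := ![u, v, w])
    (by simp [Fin.sum_univ_three, hs]) (by intro i _; fin_cases i <;> simpa)
  simpa [Fin.prod_univ_three] using this

lemma heatKer_le_rpow_mul {N : ℕ} {T a b c d u v w : ℝ}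
    (hu : 0 ≤ u) (hv : 0 ≤ v) (hw : 0 ≤ w) (hs : u + v + w = 1)
    (hd : u * a + v * b + w * c = d) (q q' : RN N × ℝ) :
    heatKer T d q q' ≤ heatKer T a q q' ^ u * heatKer T b q q' ^ v * heatKer T c q q' ^ w := by
  unfold heatKer
  set τ := q.2 - q'.2
  by_cases hτ : τ ∈ Ioo 0 T
  · simp only [indicator_of_mem hτ]
    have hτ0 : 0 < τ := hτ.1
    have hp := profile_pos (q.1 - q'.1) hτ0
    set P := profile (q.1 - q'.1) τ
    rw [ENNReal.ofReal_rpow_of_nonneg (by positivity) hu,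
      ENNReal.ofReal_rpow_of_nonneg (by positivity) hv,
      ENNReal.ofReal_rpow_of_nonneg (by positivity) hw, ← ENNReal.ofReal_mul (by positivity),
      ← ENNReal.ofReal_mul (by positivity)]
    apply le_of_eq
    congr 1
    rw [Real.mul_rpow (by positivity) hp.le, Real.mul_rpow (by positivity) hp.le,
      Real.mul_rpow (by positivity) hp.le, ← Real.rpow_mul hτ0.le, ← Real.rpow_mul hτ0.le,
      ← Real.rpow_mul hτ0.le]
    have e1 : τ ^ (-d) = τ ^ (-a * u) * τ ^ (-b * v) * τ ^ (-c * w) := by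
      rw [← Real.rpow_add hτ0, ← Real.rpow_add hτ0]
      congr 1; rw [← hd]; ring
    have e2 : P = P ^ u * P ^ v * P ^ w := by
      rw [← Real.rpow_add hp, ← Real.rpow_add hp, hs, Real.rpow_one]
    rw [e1]
    nth_rw 1 [e2]
    ring
  · simp [indicator_of_notMem hτ]

lemma heatOp_mul_le {N : ℕ} {T a b c d u v w : ℝ} {f g h : RN N × ℝ → ENNReal}
    (hf : Measurable f) (hg : Measurable g) (hh : Measurable h)
    (hu : 0 ≤ u) (hv : 0 ≤ v) (hw : 0 ≤ w) (hs : u + v + w = 1)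
    (hd : u * a + v * b + w * c = d) (q : RN N × ℝ) :
    heatOp T d (fun q => f q ^ u * g q ^ v * h q ^ w) q
      ≤ heatOp T a f q ^ u * heatOp T b g q ^ v * heatOp T c h q ^ w := by
  unfold heatOp
  refine le_trans ?_ (lintegral_rpow_mul_rpow_mul_rpow_le
    ((measurable_heatKer_right T a q).mul hf).aemeasurable
    ((measurable_heatKer_right T b q).mul hg).aemeasurable
    ((measurable_heatKer_right T c q).mul hh).aemeasurable hu hv hw hs)
  refine lintegral_mono fun q' => ?_
  simp only [Pi.mul_apply, ENNReal.mul_rpow_of_nonneg _ _ hu, ENNReal.mul_rpow_of_nonneg _ _ hv,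
    ENNReal.mul_rpow_of_nonneg _ _ hw]
  calc _ ≤ heatKer T a q q' ^ u * heatKer T b q q' ^ v * heatKer T c q q' ^ w *
        (f q' ^ u * g q' ^ v * h q' ^ w) := by
        gcongr; exact heatKer_le_rpow_mul hu hv hw hs hd q q'
    _ = _ := by ring

lemma lintegral_le_of_slices {N : ℕ} {T : ℝ} {M : RN N × ℝ → ENNReal} (hM : Measurable M)
    (hM1 : ∀ᵐ t ∂(volume.restrict (Ioo 0 T)), ∫⁻ y in cube N, M (y, t) ≤ 1) :
    ∫⁻ q, M q ∂(cylMeasure N T) ≤ ENNReal.ofReal T := by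
  rw [lintegral_cylMeasure hM]
  calc _ ≤ ∫⁻ _ in Ioo 0 T, 1 := lintegral_mono_ae hM1
    _ = _ := by simp

lemma lintegral_rpow_le_of_slices {N : ℕ} {T lam : ℝ} (h0 : 0 ≤ lam) (h1 : lam ≤ 1)
    {M : RN N × ℝ → ENNReal} (hM : Measurable M)
    (hM1 : ∀ᵐ t ∂(volume.restrict (Ioo 0 T)), ∫⁻ y in cube N, M (y, t) ≤ 1) :
    ∫⁻ q, M q ^ lam ∂(cylMeasure N T) ≤ 2 * ENNReal.ofReal T := by
  calc _ ≤ ∫⁻ q, (1 + M q) ∂(cylMeasure N T) := by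
        refine lintegral_mono fun q => ?_
        rcases le_total (M q) 1 with h | h
        · exact (ENNReal.rpow_le_one h h0).trans le_self_add
        · calc M q ^ lam ≤ M q ^ (1 : ℝ) := ENNReal.rpow_le_rpow_of_exponent_le h h1
            _ ≤ _ := by rw [ENNReal.rpow_one]; exact le_add_self
    _ ≤ ENNReal.ofReal T + ENNReal.ofReal T := by
        rw [lintegral_add_left measurable_const, lintegral_one, cylMeasure_univ]
        gcongr
        exact lintegral_le_of_slices hM hM1
    _ = _ := (two_mul _).symm

lemma lintegral_rpow_interp_le {N : ℕ} {T α β s : ℝ} (hs0 : 0 ≤ s) (hs1 : s ≤ 1)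
    (hβ : 0 ≤ β) (hα : α = s * β)
    {M : RN N × ℝ → ENNReal} (hM : Measurable M)
    (hM1 : ∀ᵐ t ∂(volume.restrict (Ioo 0 T)), ∫⁻ y in cube N, M (y, t) ≤ 1) :
    ∫⁻ q, M q ^ (α + 1) ∂(cylMeasure N T)
      ≤ (∫⁻ q, M q ^ (β + 1) ∂(cylMeasure N T)) ^ s * ENNReal.ofReal T ^ (1 - s) := by
  calc _ = ∫⁻ q, (M q ^ (β + 1)) ^ s * (M q) ^ (1 - s) ∂(cylMeasure N T) := by
        refine lintegral_congr fun q => ?_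
        rw [← ENNReal.rpow_mul, ← ENNReal.rpow_add_of_nonneg _ _ (by positivity) (by linarith)]
        congr 1
        rw [hα]; ring
    _ ≤ (∫⁻ q, M q ^ (β + 1) ∂(cylMeasure N T)) ^ s * (∫⁻ q, M q ∂(cylMeasure N T)) ^ (1 - s) :=
        ENNReal.lintegral_mul_norm_pow_le (hM.pow_const _).aemeasurable hM.aemeasurable
          hs0 (by linarith) (by ring)
    _ ≤ _ := mul_le_mul' le_rfl
        (ENNReal.rpow_le_rpow (lintegral_le_of_slices hM hM1) (by linarith))

lemma add_mul_rpow_le {p : ℝ} (hp : 1 ≤ p) (a b c : ENNReal) :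
    (a + b * c) ^ p ≤ 2 ^ (p - 1) * (a ^ p + b ^ p * c ^ p) := by
  rw [← ENNReal.mul_rpow_of_nonneg _ _ (by linarith)]
  exact ENNReal.rpow_add_le_mul_rpow_add_rpow _ _ hp

/-- A superlinear bound from a heat-potential inequality, for large exponents. -/
lemma exists_potential_bound_of_le {N : ℕ} (hN : 1 ≤ N) (T α γ' : ℝ) (hα : 0 < α) (hγ' : 1 < γ')
    (hsub : α < γ' / N) (hle : γ' ≤ α + 1) (C₀ C₁ : ENNReal) (hC₀ : C₀ ≠ ⊤) (hC₁ : C₁ ≠ ⊤) :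
    ∃ C : ENNReal, C ≠ ⊤ ∧ ∃ δ > (1 : ℝ), ∀ M Z : RN N × ℝ → ENNReal, Measurable M →
      Measurable Z → (∀ᵐ t ∂(volume.restrict (Ioo 0 T)), ∫⁻ y in cube N, M (y, t) ≤ 1) →
      (∀ᵐ q ∂(cylMeasure N T), M q ≤ C₀ + C₁ *
        heatOp T (1 / 2) (fun q => Z q ^ (1 / γ') * M q ^ (1 - 1 / γ')) q) →
      (∫⁻ q, M q ^ (α + 1) ∂(cylMeasure N T)) ^ δ ≤ C * ((∫⁻ q, Z q ∂(cylMeasure N T)) + 1) := by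
  have hN' : (1 : ℝ) ≤ N := by exact_mod_cast hN
  have hγ0 : 0 < γ' := by linarith
  obtain ⟨β, hαβ, hβ⟩ := exists_between hsub
  have hβ0 : 0 < β := hα.trans hαβ
  have hβN : β * N < γ' := by rwa [lt_div_iff₀ (by linarith)] at hβ
  have hβγ : β < γ' := by nlinarith
  set lam := 1 + β - γ' with hlam
  have hl0 : 0 ≤ lam := by linarith
  have hl1 : lam ≤ 1 := by linarith
  set κ := 1 / 2 - N * β / (2 * γ') with hκ
  have hκ0 : 0 < κ := by
    have : N * β / (2 * γ') < 1 / 2 := by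
      rw [div_lt_iff₀ (by linarith)]; linarith
    linarith
  set a := 1 - lam * N / 2 - κ with ha
  set c := 1 - 1 * N / 2 - κ with hc
  have hkA := heatKerConst_lt_top (N := N) (T := T) (a := a) hl1 (by linarith)
  have hkB := heatKerConst_lt_top (N := N) (T := T) (a := c) (lam := 1) le_rfl (by linarith)
  set kA := heatKerConst N T a lam
  set kB := heatKerConst N T c 1
  set D : ENNReal := 2 ^ (γ' - 1) * (C₀ ^ γ' * (2 * ENNReal.ofReal T)
    + C₁ ^ γ' * (kB ^ (γ' - 1) * kA)) with hD
  have hDt : D ≠ ⊤ := by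
    have h1 : (2 : ENNReal) ^ (γ' - 1) ≠ ⊤ := ENNReal.rpow_ne_top_of_nonneg (by linarith) (by simp)
    have h2 : C₀ ^ γ' ≠ ⊤ := ENNReal.rpow_ne_top_of_nonneg (by linarith) hC₀
    have h3 : C₁ ^ γ' ≠ ⊤ := ENNReal.rpow_ne_top_of_nonneg (by linarith) hC₁
    have h4 : kB ^ (γ' - 1) ≠ ⊤ := ENNReal.rpow_ne_top_of_nonneg (by linarith) hkB.ne
    have h5 := hkA.ne
    finiteness
  refine ⟨ENNReal.ofReal T ^ ((1 - α / β) * (β / α)) * D, ?_, β / α, ?_, ?_⟩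
  · have h1 : ENNReal.ofReal T ^ ((1 - α / β) * (β / α)) ≠ ⊤ := by
      apply ENNReal.rpow_ne_top_of_nonneg _ ENNReal.ofReal_ne_top
      have : α / β ≤ 1 := by rw [div_le_one hβ0]; exact hαβ.le
      have : 0 ≤ 1 - α / β := by linarith
      positivity
    finiteness
  · rw [gt_iff_lt, one_lt_div hα]; exact hαβ
  intro M Z hM hZ hM1 hMU
  set U := heatOp T (1 / 2) (fun q => Z q ^ (1 / γ') * M q ^ (1 - 1 / γ')) with hU
  have hU' : ∀ᵐ q ∂(cylMeasure N T), U q ^ γ' ≤ kB ^ (γ' - 1) * heatOp T a Z q := by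
    filter_upwards [ae_restrict_mem (measurableSet_QQ N T)] with q hq
    have h1 : U q ≤ heatOp T a Z q ^ (1 / γ') * heatOp T c M q ^ (1 - 1 / γ')
        * heatOp T c M q ^ (0 : ℝ) := by
      refine le_trans (le_of_eq ?_) (heatOp_mul_le hZ hM hM (by positivity) ?_ le_rfl (by ring)
        (d := 1 / 2) ?_ q)
      · rw [hU]; simp
      · rw [sub_nonneg, div_le_one hγ0]; exact hγ'.le
      · rw [ha, hc, hκ, hlam]; field_simp; ring
    have h2 : heatOp T c M q ≤ kB := by
      simpa using heatOp_rpow_le (a := c) (lam := 1) zero_le_one le_rfl hM hM1 hq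
    have h3 : 0 ≤ γ' - 1 := by linarith
    calc U q ^ γ' ≤ (heatOp T a Z q ^ (1 / γ') * heatOp T c M q ^ (1 - 1 / γ')) ^ γ' := by
          gcongr; simpa using h1
      _ = heatOp T a Z q * heatOp T c M q ^ (γ' - 1) := by
          rw [ENNReal.mul_rpow_of_nonneg _ _ hγ0.le, ← ENNReal.rpow_mul, ← ENNReal.rpow_mul,
            one_div_mul_cancel hγ0.ne', ENNReal.rpow_one]
          congr 2; field_simp
      _ ≤ heatOp T a Z q * kB ^ (γ' - 1) := by gcongr
      _ = _ := mul_comm _ _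
  have hKm := measurable_heatOp (N := N) T a hZ
  set S := ∫⁻ q, Z q ∂(cylMeasure N T)
  have hY : ∫⁻ q, M q ^ (β + 1) ∂(cylMeasure N T) ≤ D * (S + 1) := by
    calc _ ≤ ∫⁻ q, 2 ^ (γ' - 1) * (C₀ ^ γ' * M q ^ lam +
            C₁ ^ γ' * (kB ^ (γ' - 1) * (M q ^ lam * heatOp T a Z q))) ∂(cylMeasure N T) := by
          refine lintegral_mono_ae ?_
          filter_upwards [hMU, hU'] with q h1 h2
          calc M q ^ (β + 1) = M q ^ lam * M q ^ γ' := by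
                rw [← ENNReal.rpow_add_of_nonneg _ _ hl0 hγ0.le]; congr 1; rw [hlam]; ring
            _ ≤ M q ^ lam * (2 ^ (γ' - 1) * (C₀ ^ γ' + C₁ ^ γ' * (kB ^ (γ' - 1) *
                  heatOp T a Z q))) := by
                gcongr
                calc M q ^ γ' ≤ (C₀ + C₁ * U q) ^ γ' := by gcongr
                  _ ≤ 2 ^ (γ' - 1) * (C₀ ^ γ' + C₁ ^ γ' * U q ^ γ') :=
                    add_mul_rpow_le hγ'.le _ _ _
                  _ ≤ _ := by gcongr
            _ = _ := by ring
      _ = 2 ^ (γ' - 1) * (C₀ ^ γ' * (∫⁻ q, M q ^ lam ∂(cylMeasure N T)) +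
            C₁ ^ γ' * (kB ^ (γ' - 1) *
              ∫⁻ q, M q ^ lam * heatOp T a Z q ∂(cylMeasure N T))) := by
          rw [lintegral_const_mul _ (by fun_prop), lintegral_add_left (by fun_prop),
            lintegral_const_mul _ (by fun_prop), lintegral_const_mul _ (by fun_prop),
            lintegral_const_mul _ (by fun_prop)]
      _ ≤ 2 ^ (γ' - 1) * (C₀ ^ γ' * (2 * ENNReal.ofReal T * (S + 1)) +
            C₁ ^ γ' * (kB ^ (γ' - 1) * (kA * (S + 1)))) := by
          gcongr
          · calc _ ≤ 2 * ENNReal.ofReal T * 1 := by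
                  rw [mul_one]; exact lintegral_rpow_le_of_slices hl0 hl1 hM hM1
              _ ≤ _ := by gcongr; exact le_add_self
          · calc _ ≤ kA * S := lintegral_rpow_mul_heatOp_le hl0 hl1 hM hZ hM1
              _ ≤ _ := by gcongr; exact le_self_add
      _ = _ := by rw [hD]; ring
  calc _ ≤ ((∫⁻ q, M q ^ (β + 1) ∂(cylMeasure N T)) ^ (α / β) *
          ENNReal.ofReal T ^ (1 - α / β)) ^ (β / α) := by
        gcongr
        apply lintegral_rpow_interp_le (by positivity) (by rw [div_le_one hβ0]; exact hαβ.le)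
          hβ0.le (by field_simp) hM hM1
    _ = (∫⁻ q, M q ^ (β + 1) ∂(cylMeasure N T)) * ENNReal.ofReal T ^ ((1 - α / β) * (β / α)) := by
        rw [ENNReal.mul_rpow_of_nonneg _ _ (by positivity), ← ENNReal.rpow_mul,
          ← ENNReal.rpow_mul, div_mul_div_cancel₀ hβ0.ne', div_self hα.ne', ENNReal.rpow_one]
    _ ≤ (D * (S + 1)) * ENNReal.ofReal T ^ ((1 - α / β) * (β / α)) := by gcongr
    _ = _ := by ring

/-- A superlinear bound from a heat-potential inequality, for small exponents. -/
lemma exists_potential_bound_of_lt {N : ℕ} (hN : 1 ≤ N) (T α γ' : ℝ) (hα : 0 < α) (hγ' : 1 < γ')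
    (hsub : α < γ' / N) (hlt : α + 1 < γ') (C₀ C₁ : ENNReal) (hC₀ : C₀ ≠ ⊤) (hC₁ : C₁ ≠ ⊤) :
    ∃ C : ENNReal, C ≠ ⊤ ∧ ∃ δ > (1 : ℝ), ∀ M Z : RN N × ℝ → ENNReal, Measurable M →
      Measurable Z → (∀ᵐ t ∂(volume.restrict (Ioo 0 T)), ∫⁻ y in cube N, M (y, t) ≤ 1) →
      (∀ᵐ q ∂(cylMeasure N T), M q ≤ C₀ + C₁ *
        heatOp T (1 / 2) (fun q => Z q ^ (1 / γ') * M q ^ (1 - 1 / γ')) q) →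
      ∫⁻ q, M q ^ (α + 1) ∂(cylMeasure N T) ≠ ⊤ →
      (∫⁻ q, M q ^ (α + 1) ∂(cylMeasure N T)) ^ δ ≤ C * ((∫⁻ q, Z q ∂(cylMeasure N T)) + 1) := by
  have hN' : (1 : ℝ) ≤ N := by exact_mod_cast hN
  have hγ0 : 0 < γ' := by linarith
  have hαN : α * N < γ' := by rwa [lt_div_iff₀ (by linarith)] at hsub
  set p := α + 1 with hp
  have hp0 : 0 < p := by linarith
  set ρ := p / γ' with hρ
  have hρ0 : 0 < ρ := by positivity
  have hρ1 : ρ < 1 := by rw [hρ, div_lt_one hγ0]; exact hlt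
  have hαN0 : 0 < α * N := by positivity
  obtain ⟨lam, hρl, hl⟩ : ∃ lam, ρ < lam ∧ lam < min 1 (p / (α * N)) := by
    apply exists_between
    rw [lt_min_iff]
    refine ⟨hρ1, ?_⟩
    rw [hρ]
    exact div_lt_div_of_pos_left hp0 hαN0 hαN
  obtain ⟨hl1, hl2⟩ := lt_min_iff.1 hl
  rw [lt_div_iff₀ hαN0] at hl2
  have hl0 : 0 < lam := hρ0.trans hρl
  set θ := (1 - lam) / (1 - ρ) with hθ
  have hθ0 : 0 ≤ θ := div_nonneg (by linarith) (by linarith)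
  have hθ1 : θ ≤ 1 := by rw [hθ, div_le_one (by linarith)]; linarith
  have hθρ : θ * (1 - ρ) = 1 - lam := div_mul_cancel₀ _ (by linarith)
  set κ := 1 / 2 - α * lam * N / (2 * p) with hκ
  have hκ0 : 0 < κ := by
    have : α * lam * N / (2 * p) < 1 / 2 := by
      rw [div_lt_iff₀ (by linarith)]; linarith
    linarith
  set a := 1 - κ with ha
  set c := 1 - lam * N / 2 - κ with hc
  have hkA := heatKerConst_lt_top (N := N) (T := T) (a := a) zero_le_one (by linarith)
  have hkB := heatKerConst_lt_top (N := N) (T := T) (a := c) hl1.le (by linarith)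
  set kA := heatKerConst N T a 0
  set kB := heatKerConst N T c lam
  set D : ENNReal := 2 ^ (p - 1) * (C₀ ^ p * ENNReal.ofReal T
    + C₁ ^ p * (kB ^ α * (kA ^ ρ * (kA ^ (1 - ρ) * ENNReal.ofReal T ^ ((1 - θ) * (1 - ρ))))))
    with hD
  have hDt : D ≠ ⊤ := by
    have h1 : (2 : ENNReal) ^ (p - 1) ≠ ⊤ := ENNReal.rpow_ne_top_of_nonneg (by linarith) (by simp)
    have h2 : C₀ ^ p ≠ ⊤ := ENNReal.rpow_ne_top_of_nonneg (by linarith) hC₀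
    have h3 : C₁ ^ p ≠ ⊤ := ENNReal.rpow_ne_top_of_nonneg (by linarith) hC₁
    have h4 : kB ^ α ≠ ⊤ := ENNReal.rpow_ne_top_of_nonneg (by linarith) hkB.ne
    have h5 : kA ^ ρ ≠ ⊤ := ENNReal.rpow_ne_top_of_nonneg (by linarith) hkA.ne
    have h6 : kA ^ (1 - ρ) ≠ ⊤ := ENNReal.rpow_ne_top_of_nonneg (by linarith) hkA.ne
    have h7 : ENNReal.ofReal T ^ ((1 - θ) * (1 - ρ)) ≠ ⊤ := by
      apply ENNReal.rpow_ne_top_of_nonneg _ ENNReal.ofReal_ne_top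
      exact mul_nonneg (by linarith) (by linarith)
    finiteness
  refine ⟨1 + (D * 2) ^ (1 / ρ), ?_, lam / ρ, ?_, ?_⟩
  · have : (D * 2) ^ (1 / ρ) ≠ ⊤ := by
      apply ENNReal.rpow_ne_top_of_nonneg (by positivity)
      finiteness
    finiteness
  · rw [gt_iff_lt, one_lt_div hρ0]; exact hρl
  intro M Z hM hZ hM1 hMU hX
  set U := heatOp T (1 / 2) (fun q => Z q ^ (1 / γ') * M q ^ (1 - 1 / γ')) with hU
  set S := ∫⁻ q, Z q ∂(cylMeasure N T) with hS
  set X := ∫⁻ q, M q ^ p ∂(cylMeasure N T) with hXdef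
  have hα1 : α = p - 1 := by rw [hp]; ring
  have hw0 : 0 ≤ 1 / p - 1 / γ' := by
    rw [sub_nonneg]; exact one_div_le_one_div_of_le hp0 hlt.le
  have hwp : (1 / p - 1 / γ') * p = 1 - ρ := by rw [hρ]; field_simp
  have hU' : ∀ᵐ q ∂(cylMeasure N T), U q ^ p ≤ kB ^ α *
      (heatOp T a Z q ^ ρ * heatOp T a (fun q => M q ^ (α * θ + 1)) q ^ (1 - ρ)) := by
    filter_upwards [ae_restrict_mem (measurableSet_QQ N T)] with q hq
    have h1 : U q ≤ heatOp T a Z q ^ (1 / γ') *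
        heatOp T a (fun q => M q ^ (α * θ + 1)) q ^ (1 / p - 1 / γ')
        * heatOp T c (fun q => M q ^ lam) q ^ (α / p) := by
      refine le_trans (le_of_eq ?_) (heatOp_mul_le hZ (hM.pow_const _) (hM.pow_const _)
        (by positivity) hw0 (by positivity) ?_ (d := 1 / 2) ?_ q)
      · rw [hU]
        congr 1
        funext q
        rw [mul_assoc, ← ENNReal.rpow_mul, ← ENNReal.rpow_mul,
          ← ENNReal.rpow_add_of_nonneg _ _ (by positivity) (by positivity)]
        congr 2
        have e : lam = 1 - θ * (1 - ρ) := by linarith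
        have e2 : 1 / p - 1 / γ' = (1 - ρ) / p := by rw [hρ]; field_simp
        have e3 : 1 / γ' = ρ / p := by rw [hρ]; field_simp
        rw [e2, e3, e]
        field_simp
        rw [hα1]; ring
      · field_simp; rw [hα1]; ring
      · rw [hc, ha, hκ]; field_simp; rw [hα1]; ring
    have h2 : heatOp T c (fun q => M q ^ lam) q ≤ kB := heatOp_rpow_le hl0.le hl1.le hM hM1 hq
    calc U q ^ p ≤ (heatOp T a Z q ^ (1 / γ') *
        heatOp T a (fun q => M q ^ (α * θ + 1)) q ^ (1 / p - 1 / γ')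
        * kB ^ (α / p)) ^ p := by
          gcongr
          refine h1.trans ?_
          gcongr
      _ = _ := by
          rw [ENNReal.mul_rpow_of_nonneg _ _ hp0.le, ENNReal.mul_rpow_of_nonneg _ _ hp0.le,
            ← ENNReal.rpow_mul, ← ENNReal.rpow_mul, ← ENNReal.rpow_mul, hwp,
            div_mul_cancel₀ _ hp0.ne', one_div_mul_eq_div, ← hρ]
          ring
  have hKm := measurable_heatOp (N := N) T a hZ
  have hKm2 := measurable_heatOp (N := N) T a (hM.pow_const (α * θ + 1))
  have hρ' : 0 ≤ 1 - ρ := by linarith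
  have hY : ∫⁻ q, M q ^ (α * θ + 1) ∂(cylMeasure N T)
      ≤ X ^ θ * ENNReal.ofReal T ^ (1 - θ) :=
    lintegral_rpow_interp_le hθ0 hθ1 hα.le (mul_comm _ _) hM hM1
  have hUint : ∫⁻ q, heatOp T a Z q ^ ρ * heatOp T a (fun q => M q ^ (α * θ + 1)) q ^ (1 - ρ)
        ∂(cylMeasure N T)
      ≤ (kA ^ ρ * (kA ^ (1 - ρ) * ENNReal.ofReal T ^ ((1 - θ) * (1 - ρ)))) *
        (S ^ ρ * X ^ (1 - lam)) := by
    calc _ ≤ (∫⁻ q, heatOp T a Z q ∂(cylMeasure N T)) ^ ρ *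
          (∫⁻ q, heatOp T a (fun q => M q ^ (α * θ + 1)) q ∂(cylMeasure N T)) ^ (1 - ρ) :=
          ENNReal.lintegral_mul_norm_pow_le hKm.aemeasurable hKm2.aemeasurable hρ0.le hρ' (by ring)
      _ ≤ (kA * S) ^ ρ * (kA * (X ^ θ * ENNReal.ofReal T ^ (1 - θ))) ^ (1 - ρ) := by
          gcongr
          · exact lintegral_heatOp_le hZ
          · refine (lintegral_heatOp_le (hM.pow_const _)).trans ?_
            gcongr
      _ = _ := by
          rw [ENNReal.mul_rpow_of_nonneg _ _ hρ0.le, ENNReal.mul_rpow_of_nonneg _ _ hρ',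
            ENNReal.mul_rpow_of_nonneg _ _ hρ', ← ENNReal.rpow_mul, ← ENNReal.rpow_mul, hθρ]
          ring
  have hmain : X ≤ D * (1 + S ^ ρ * X ^ (1 - lam)) := by
    calc X ≤ ∫⁻ q, 2 ^ (p - 1) * (C₀ ^ p + C₁ ^ p * (kB ^ α *
          (heatOp T a Z q ^ ρ * heatOp T a (fun q => M q ^ (α * θ + 1)) q ^ (1 - ρ))))
          ∂(cylMeasure N T) := by
          refine lintegral_mono_ae ?_
          filter_upwards [hMU, hU'] with q h1 h2
          calc M q ^ p ≤ (C₀ + C₁ * U q) ^ p := by gcongr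
            _ ≤ 2 ^ (p - 1) * (C₀ ^ p + C₁ ^ p * U q ^ p) :=
              add_mul_rpow_le (by linarith) _ _ _
            _ ≤ _ := by gcongr
      _ = 2 ^ (p - 1) * (C₀ ^ p * ENNReal.ofReal T + C₁ ^ p * (kB ^ α *
          ∫⁻ q, heatOp T a Z q ^ ρ * heatOp T a (fun q => M q ^ (α * θ + 1)) q ^ (1 - ρ)
          ∂(cylMeasure N T))) := by
          rw [lintegral_const_mul _ (by fun_prop), lintegral_add_left (by fun_prop),
            lintegral_const_mul _ (by fun_prop), lintegral_const_mul _ (by fun_prop),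
            lintegral_const, cylMeasure_univ]
      _ ≤ 2 ^ (p - 1) * (C₀ ^ p * (ENNReal.ofReal T * (1 + S ^ ρ * X ^ (1 - lam))) +
          C₁ ^ p * (kB ^ α *
          ((kA ^ ρ * (kA ^ (1 - ρ) * ENNReal.ofReal T ^ ((1 - θ) * (1 - ρ)))) *
            (1 + S ^ ρ * X ^ (1 - lam))))) := by
          gcongr
          · exact le_mul_of_one_le_right' le_self_add
          · refine hUint.trans ?_
            gcongr
            exact le_add_self
      _ = _ := by rw [hD]; ring
  rcases le_or_gt X 1 with h | h
  · calc X ^ (lam / ρ) ≤ 1 := ENNReal.rpow_le_one h (by positivity)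
      _ ≤ 1 + (D * 2) ^ (1 / ρ) := le_self_add
      _ ≤ _ := le_mul_of_one_le_right' le_add_self
  have hX0 : X ≠ 0 := (zero_lt_one.trans h).ne'
  have hXl1 : 1 ≤ X ^ (1 - lam) := ENNReal.one_le_rpow h.le (by linarith)
  have h1 : X ^ lam ≤ D * 2 * (S + 1) ^ ρ := by
    have h2 : X ≤ D * 2 * (S + 1) ^ ρ * X ^ (1 - lam) := by
      calc X ≤ D * (1 + S ^ ρ * X ^ (1 - lam)) := hmain
        _ ≤ D * ((S + 1) ^ ρ * X ^ (1 - lam) + (S + 1) ^ ρ * X ^ (1 - lam)) := by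
            gcongr
            · calc (1 : ENNReal) = 1 * 1 := (mul_one 1).symm
                _ ≤ _ := by
                  gcongr
                  exact ENNReal.one_le_rpow le_add_self (by linarith)
            · exact le_self_add
        _ = _ := by ring
    have h3 : X = X ^ lam * X ^ (1 - lam) := by
      rw [← ENNReal.rpow_add _ _ hX0 hX, add_sub_cancel, ENNReal.rpow_one]
    nth_rw 1 [h3] at h2
    exact (ENNReal.mul_le_mul_iff_left (by positivity)
      (ENNReal.rpow_ne_top_of_nonneg (by linarith) hX)).1 h2
  calc X ^ (lam / ρ) = (X ^ lam) ^ (1 / ρ) := by rw [← ENNReal.rpow_mul]; ring_nf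
    _ ≤ (D * 2 * (S + 1) ^ ρ) ^ (1 / ρ) := by gcongr
    _ = (D * 2) ^ (1 / ρ) * (S + 1) := by
        rw [ENNReal.mul_rpow_of_nonneg _ _ (by positivity), ← ENNReal.rpow_mul,
          mul_one_div_cancel hρ0.ne', ENNReal.rpow_one]
    _ ≤ _ := by gcongr; exact le_add_self

/-- A superlinear bound from a heat-potential inequality. -/
lemma exists_potential_bound {N : ℕ} (hN : 1 ≤ N) (T α γ' : ℝ) (hα : 0 ≤ α) (hγ' : 1 < γ')
    (hsub : α < γ' / N) (C₀ C₁ : ENNReal) (hC₀ : C₀ ≠ ⊤) (hC₁ : C₁ ≠ ⊤) :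
    ∃ C : ENNReal, C ≠ ⊤ ∧ ∃ δ > (1 : ℝ), ∀ M Z : RN N × ℝ → ENNReal, Measurable M →
      Measurable Z → (∀ᵐ t ∂(volume.restrict (Ioo 0 T)), ∫⁻ y in cube N, M (y, t) ≤ 1) →
      (∀ᵐ q ∂(cylMeasure N T), M q ≤ C₀ + C₁ *
        heatOp T (1 / 2) (fun q => Z q ^ (1 / γ') * M q ^ (1 - 1 / γ')) q) →
      ∫⁻ q, M q ^ (α + 1) ∂(cylMeasure N T) ≠ ⊤ →
      (∫⁻ q, M q ^ (α + 1) ∂(cylMeasure N T)) ^ δ ≤ C * ((∫⁻ q, Z q ∂(cylMeasure N T)) + 1) := by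
  rcases hα.eq_or_lt with rfl | hα
  · refine ⟨ENNReal.ofReal T ^ (2 : ℝ), by finiteness, 2, by norm_num, ?_⟩
    intro M Z hM _ hM1 _ _
    calc _ ≤ ENNReal.ofReal T ^ (2 : ℝ) := by
          gcongr
          simpa using lintegral_le_of_slices hM hM1
      _ ≤ _ := le_mul_of_one_le_right' le_add_self
  rcases le_or_gt γ' (α + 1) with h | h
  · obtain ⟨C, hC, δ, hδ, H⟩ :=
      exists_potential_bound_of_le hN T α γ' hα hγ' hsub h C₀ C₁ hC₀ hC₁
    exact ⟨C, hC, δ, hδ, fun M Z h1 h2 h3 h4 _ => H M Z h1 h2 h3 h4⟩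
  · exact exists_potential_bound_of_lt hN T α γ' hα hγ' hsub h C₀ C₁ hC₀ hC₁

/-- A smooth monotone cutoff, vanishing for `τ ≤ ε` and equal to `1` for `τ ≥ 2ε`. -/
def timeCut (ε τ : ℝ) : ℝ := Real.smoothTransition (τ / ε - 1)

lemma contDiff_timeCut (ε : ℝ) : ContDiff ℝ (⊤ : ℕ∞) (timeCut ε) := by
  unfold timeCut
  exact Real.smoothTransition.contDiff.comp (by fun_prop)

lemma timeCut_nonneg (ε τ : ℝ) : 0 ≤ timeCut ε τ := Real.smoothTransition.nonneg _

lemma timeCut_le_one (ε τ : ℝ) : timeCut ε τ ≤ 1 := Real.smoothTransition.le_one _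

lemma timeCut_eq_zero {ε τ : ℝ} (hε : 0 < ε) (h : τ ≤ ε) : timeCut ε τ = 0 := by
  apply Real.smoothTransition.zero_of_nonpos
  have : τ / ε ≤ 1 := (div_le_one hε).2 h
  linarith

lemma timeCut_eq_one {ε τ : ℝ} (hε : 0 < ε) (h : 2 * ε ≤ τ) : timeCut ε τ = 1 := by
  apply Real.smoothTransition.one_of_one_le
  have : 2 ≤ τ / ε := (le_div_iff₀ hε).2 h
  linarith

lemma monotone_timeCut {ε : ℝ} (hε : 0 < ε) : Monotone (timeCut ε) := fun a b hab =>
  Real.smoothTransition.monotone (by gcongr)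

lemma deriv_timeCut_nonneg {ε : ℝ} (hε : 0 < ε) (τ : ℝ) : 0 ≤ deriv (timeCut ε) τ :=
  (monotone_timeCut hε).deriv_nonneg

lemma deriv_timeCut_eq_zero {ε τ : ℝ} (hε : 0 < ε) (h : τ < ε) : deriv (timeCut ε) τ = 0 := by
  have : timeCut ε =ᶠ[𝓝 τ] fun _ => 0 := by
    filter_upwards [Iio_mem_nhds h] with s hs
    exact timeCut_eq_zero hε (le_of_lt hs)
  rw [this.deriv_eq, deriv_const]

lemma hasDerivAt_timeCut (ε τ : ℝ) : HasDerivAt (timeCut ε) (deriv (timeCut ε) τ) τ :=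
  ((contDiff_timeCut ε).differentiable (by simp)).differentiableAt.hasDerivAt

/-- The derivative of `circleSq`. -/
def circleSqDeriv (z : ℝ) : ℝ := 2 * Real.sin (Real.pi * z) * Real.cos (Real.pi * z) / Real.pi

lemma hasDerivAt_circleSq (z : ℝ) : HasDerivAt circleSq (circleSqDeriv z) z := by
  have h1 : HasDerivAt (fun z => Real.sin (Real.pi * z)) (Real.cos (Real.pi * z) * Real.pi) z := by
    simpa using ((hasDerivAt_id z).const_mul Real.pi).sin
  have := (h1.pow 2).div_const (Real.pi ^ 2)
  refine this.congr_deriv ?_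
  have := Real.pi_pos
  unfold circleSqDeriv
  field_simp
  norm_num
  ring

lemma hasDerivAt_circleSqDeriv (z : ℝ) :
    HasDerivAt circleSqDeriv (2 - 4 * Real.pi ^ 2 * circleSq z) z := by
  have h1 : HasDerivAt (fun z => Real.sin (Real.pi * z)) (Real.cos (Real.pi * z) * Real.pi) z := by
    simpa using ((hasDerivAt_id z).const_mul Real.pi).sin
  have h2 : HasDerivAt (fun z => Real.cos (Real.pi * z)) (-Real.sin (Real.pi * z) * Real.pi) z := by
    simpa using ((hasDerivAt_id z).const_mul Real.pi).cos
  have := ((h1.const_mul 2).mul h2).div_const Real.pi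
  refine this.congr_deriv ?_
  have hπ := Real.pi_pos
  unfold circleSq
  field_simp
  have := Real.sin_sq_add_cos_sq (Real.pi * z)
  linear_combination 2 * this

lemma circleSqDeriv_sq (z : ℝ) :
    circleSqDeriv z ^ 2 = 4 * circleSq z - 4 * Real.pi ^ 2 * circleSq z ^ 2 := by
  have hπ := Real.pi_pos
  unfold circleSq circleSqDeriv
  field_simp
  have := Real.sin_sq_add_cos_sq (Real.pi * z)
  linear_combination 4 * Real.sin (Real.pi * z) ^ 2 * this

lemma contDiff_torusSq {N : ℕ} : ContDiff ℝ (⊤ : ℕ∞) (torusSq (N := N)) := by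
  unfold torusSq circleSq
  fun_prop

lemma hasFDerivAt_torusSq {N : ℕ} (z : RN N) :
    HasFDerivAt torusSq (∑ i, circleSqDeriv (z i) •
      (ContinuousLinearMap.proj i : RN N →L[ℝ] ℝ)) z := by
  unfold torusSq
  refine HasFDerivAt.fun_sum fun i _ => ?_
  have h : HasFDerivAt (fun z : RN N => z i) (ContinuousLinearMap.proj i : RN N →L[ℝ] ℝ) z :=
    hasFDerivAt_apply i z
  exact (hasDerivAt_circleSq (z i)).comp_hasFDerivAt z h

/-- The Gaussian in the periodic distance of the torus, an approximate heat kernel. -/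
def torusGauss {N : ℕ} (z : RN N) (τ : ℝ) : ℝ :=
  τ ^ (-((N : ℝ) / 2)) * Real.exp (-(torusSq z) / (4 * τ))

lemma torusGauss_nonneg {N : ℕ} (z : RN N) {τ : ℝ} (hτ : 0 < τ) : 0 ≤ torusGauss z τ := by
  unfold torusGauss; positivity

lemma hasDerivAt_torusGauss {N : ℕ} (z : RN N) {τ : ℝ} (hτ : 0 < τ) :
    HasDerivAt (torusGauss z)
      (torusGauss z τ * (torusSq z / (4 * τ ^ 2) - N / (2 * τ))) τ := by
  have h1 := Real.hasDerivAt_rpow_const (x := τ) (p := -((N : ℝ) / 2)) (Or.inl hτ.ne')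
  have h2 : HasDerivAt (fun τ : ℝ => -(torusSq z) / (4 * τ)) (torusSq z / (4 * τ ^ 2)) τ := by
    have := (((hasDerivAt_id τ).const_mul 4).inv (by simp; exact hτ.ne')).const_mul (-(torusSq z))
    refine (this.congr_deriv ?_).congr_of_eventuallyEq (Eventually.of_forall fun s => ?_)
    · simp; field_simp
    · simp [div_eq_mul_inv]
  refine (h1.mul h2.exp).congr_deriv ?_
  unfold torusGauss
  rw [Real.rpow_sub hτ, Real.rpow_one]
  field_simp
  ring

/-- The Gaussian cut off for small times. -/
def cutGauss {N : ℕ} (ε : ℝ) (z : RN N) (τ : ℝ) : ℝ := timeCut ε τ * torusGauss z τ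

lemma cutGauss_eq_zero {N : ℕ} {ε : ℝ} (hε : 0 < ε) (z : RN N) {τ : ℝ} (h : τ ≤ ε) :
    cutGauss ε z τ = 0 := by
  unfold cutGauss; rw [timeCut_eq_zero hε h, zero_mul]

lemma contDiff_cutGauss {N : ℕ} {ε : ℝ} (hε : 0 < ε) :
    ContDiff ℝ (⊤ : ℕ∞) fun q : RN N × ℝ => cutGauss ε q.1 q.2 := by
  rw [contDiff_iff_contDiffAt]
  intro q
  rcases lt_or_ge q.2 ε with h | h
  · have : (fun q : RN N × ℝ => cutGauss ε q.1 q.2) =ᶠ[𝓝 q] fun _ => 0 := by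
      filter_upwards [(isOpen_lt continuous_snd continuous_const).mem_nhds h] with s hs
      exact cutGauss_eq_zero hε _ (le_of_lt hs)
    exact contDiffAt_const.congr_of_eventuallyEq this
  · have hq : q.2 ≠ 0 := (hε.trans_le h).ne'
    unfold cutGauss torusGauss
    have h1 : ContDiffAt ℝ (⊤ : ℕ∞) (fun q : RN N × ℝ => timeCut ε q.2) q :=
      ((contDiff_timeCut ε).comp contDiff_snd).contDiffAt
    have h2 : ContDiffAt ℝ (⊤ : ℕ∞) (fun q : RN N × ℝ => torusSq q.1) q :=
      (contDiff_torusSq.comp contDiff_fst).contDiffAt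
    have h3 : ContDiffAt ℝ (⊤ : ℕ∞) (fun q : RN N × ℝ => q.2) q := contDiffAt_snd
    exact h1.mul ((h3.rpow_const_of_ne hq).mul
      ((h2.neg.div (contDiffAt_const.mul h3) (by simpa using hq)).exp))

lemma hasDerivAt_cutGauss {N : ℕ} {ε : ℝ} (hε : 0 < ε) (z : RN N) (τ : ℝ) :
    HasDerivAt (cutGauss ε z) (deriv (timeCut ε) τ * torusGauss z τ +
      cutGauss ε z τ * (torusSq z / (4 * τ ^ 2) - N / (2 * τ))) τ := by
  rcases lt_or_ge τ ε with h | h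
  · rw [deriv_timeCut_eq_zero hε h, cutGauss_eq_zero hε z h.le]
    have : cutGauss ε z =ᶠ[𝓝 τ] fun _ => 0 := by
      filter_upwards [Iio_mem_nhds h] with s hs
      exact cutGauss_eq_zero hε z (le_of_lt hs)
    simpa using (hasDerivAt_const τ (0 : ℝ)).congr_of_eventuallyEq this
  · refine ((hasDerivAt_timeCut ε τ).mul (hasDerivAt_torusGauss z (hε.trans_le h))).congr_deriv ?_
    unfold cutGauss
    ring

lemma hasFDerivAt_cutGauss_sub {N : ℕ} (ε τ : ℝ) (x y : RN N) :
    HasFDerivAt (fun y => cutGauss ε (x - y) τ) (∑ i, (cutGauss ε (x - y) τ *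
      (circleSqDeriv ((x - y) i) / (4 * τ))) • (ContinuousLinearMap.proj i : RN N →L[ℝ] ℝ)) y := by
  have h1 : HasFDerivAt (fun y => x - y) (-ContinuousLinearMap.id ℝ (RN N)) y :=
    (hasFDerivAt_id y).const_sub x
  have h2 := ((((hasFDerivAt_torusSq (x - y)).comp y h1).neg.mul_const (4 * τ)⁻¹).exp.const_mul
    (τ ^ (-((N : ℝ) / 2)))).const_mul (timeCut ε τ)
  refine (h2.congr_fderiv ?_).congr_of_eventuallyEq (Eventually.of_forall fun s => ?_)
  · ext v
    simp [cutGauss, torusGauss, Finset.mul_sum, div_eq_mul_inv]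
    refine Finset.sum_congr rfl fun i _ => ?_
    ring
  · simp [cutGauss, torusGauss, div_eq_mul_inv]

lemma pd_cutGauss_sub {N : ℕ} (ε τ : ℝ) (x y : RN N) (i : Fin N) :
    pd i (fun y => cutGauss ε (x - y) τ) y
      = cutGauss ε (x - y) τ * (circleSqDeriv ((x - y) i) / (4 * τ)) := by
  unfold pd
  rw [(hasFDerivAt_cutGauss_sub ε τ x y).fderiv]
  simp [Pi.single_apply]

lemma pd_pd_cutGauss_sub {N : ℕ} (ε τ : ℝ) (x y : RN N) (i : Fin N) :
    pd i (pd i fun y => cutGauss ε (x - y) τ) y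
      = cutGauss ε (x - y) τ * (circleSqDeriv ((x - y) i) ^ 2 / (4 * τ) ^ 2
        - (2 - 4 * Real.pi ^ 2 * circleSq ((x - y) i)) / (4 * τ)) := by
  have e : (pd i fun y => cutGauss ε (x - y) τ)
      = fun y => cutGauss ε (x - y) τ * (circleSqDeriv ((x - y) i) / (4 * τ)) :=
    funext fun y => pd_cutGauss_sub ε τ x y i
  rw [e]
  have h1 : HasFDerivAt (fun y : RN N => (x - y) i)
      (-(ContinuousLinearMap.proj i : RN N →L[ℝ] ℝ)) y := by
    simpa using (hasFDerivAt_apply i y).const_sub (x i)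
  have h2 := ((hasDerivAt_circleSqDeriv ((x - y) i)).comp_hasFDerivAt y h1).mul_const (4 * τ)⁻¹
  have h3 := (hasFDerivAt_cutGauss_sub ε τ x y).mul h2
  unfold pd
  simp only [div_eq_mul_inv]
  have h4 := h3.fderiv
  simp only [Function.comp_def, Pi.mul_def] at h4
  rw [h4]
  simp [Pi.single_apply]
  ring

/-- The defect of the approximate heat kernel, relative to the kernel. -/
def heatDefect {N : ℕ} (z : RN N) (τ : ℝ) : ℝ :=
  Real.pi ^ 2 * (∑ i, circleSq (z i) ^ 2) / (4 * τ ^ 2) - Real.pi ^ 2 * torusSq z / τ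

lemma deriv_add_lap_cutGauss {N : ℕ} {ε : ℝ} (hε : 0 < ε) (x y : RN N) (t s : ℝ) :
    deriv (fun s => cutGauss ε (x - y) (t - s)) s + lap (fun y => cutGauss ε (x - y) (t - s)) y
      = -(deriv (timeCut ε) (t - s) * torusGauss (x - y) (t - s))
        - cutGauss ε (x - y) (t - s) * heatDefect (x - y) (t - s) := by
  have h1 : HasDerivAt (fun s => t - s) (-1) s := by
    simpa using (hasDerivAt_id s).const_sub t
  have h2 := ((hasDerivAt_cutGauss hε (x - y) (t - s)).comp s h1).deriv
  simp only [Function.comp_def] at h2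
  rw [h2]
  unfold lap
  simp_rw [pd_pd_cutGauss_sub, circleSqDeriv_sq]
  rcases lt_or_ge (t - s) ε with h | h
  · simp [cutGauss_eq_zero hε _ h.le]
  have hτ : 0 < t - s := hε.trans_le h
  rw [← Finset.mul_sum, Finset.sum_sub_distrib, ← Finset.sum_div, ← Finset.sum_div,
    Finset.sum_sub_distrib, Finset.sum_sub_distrib, ← Finset.mul_sum, ← Finset.mul_sum,
    ← Finset.mul_sum]
  have e : ∑ i, circleSq ((x - y) i) = torusSq (x - y) := rfl
  rw [e]
  simp only [Finset.sum_const, Finset.card_univ, Fintype.card_fin, nsmul_eq_mul]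
  unfold heatDefect
  field_simp
  ring

lemma torusGauss_eq {N : ℕ} (z : RN N) {τ : ℝ} (hτ : 0 < τ) :
    torusGauss z τ = profile z τ * Real.exp (-(torusSq z / τ) / 8) := by
  unfold torusGauss profile
  rw [mul_assoc, ← Real.exp_add]
  congr 2
  field_simp
  ring

lemma torusGauss_le_profile {N : ℕ} (z : RN N) {τ : ℝ} (hτ : 0 < τ) :
    torusGauss z τ ≤ profile z τ := by
  rw [torusGauss_eq z hτ]
  apply mul_le_of_le_one_right (profile_nonneg z hτ)
  rw [Real.exp_le_one_iff]
  have := torusSq_nonneg z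
  have : 0 ≤ torusSq z / τ := by positivity
  linarith

lemma cutGauss_nonneg {N : ℕ} {ε : ℝ} (hε : 0 < ε) (z : RN N) (τ : ℝ) : 0 ≤ cutGauss ε z τ := by
  rcases lt_or_ge τ ε with h | h
  · rw [cutGauss_eq_zero hε z h.le]
  · exact mul_nonneg (timeCut_nonneg _ _) (torusGauss_nonneg z (hε.trans_le h))

lemma cutGauss_le {N : ℕ} (ε : ℝ) (z : RN N) {τ : ℝ} (hτ : 0 < τ) :
    cutGauss ε z τ ≤ torusGauss z τ :=
  mul_le_of_le_one_left (torusGauss_nonneg z hτ) (timeCut_le_one _ _)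

lemma abs_heatDefect_mul_le {N : ℕ} (z : RN N) {τ : ℝ} (hτ : 0 < τ) :
    torusGauss z τ * |heatDefect z τ| ≤ 40 * Real.pi ^ 2 * profile z τ := by
  have hd := torusSq_nonneg z
  set u := torusSq z / τ with hu
  have hu0 : 0 ≤ u := by positivity
  have h1 : ∑ i, circleSq (z i) ^ 2 ≤ torusSq z ^ 2 := by
    unfold torusSq
    exact Finset.sum_sq_le_sq_sum_of_nonneg fun i _ => circleSq_nonneg _
  have h0 : 0 ≤ ∑ i, circleSq (z i) ^ 2 := Finset.sum_nonneg fun i _ => sq_nonneg _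
  have h2 : |heatDefect z τ| ≤ Real.pi ^ 2 * (u ^ 2 / 4 + u) := by
    have e : Real.pi ^ 2 * (u ^ 2 / 4 + u) = Real.pi ^ 2 * torusSq z ^ 2 / (4 * τ ^ 2)
        + Real.pi ^ 2 * torusSq z / τ := by rw [hu]; field_simp
    rw [e]
    unfold heatDefect
    refine (abs_sub _ _).trans ?_
    rw [abs_of_nonneg (by positivity), abs_of_nonneg (by positivity)]
    gcongr
  have h3 : u ^ 2 / 4 + u ≤ 40 * Real.exp (u / 8) := by
    have := Real.quadratic_le_exp_of_nonneg (x := u / 8) (by positivity)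
    nlinarith
  rw [torusGauss_eq z hτ, ← hu]
  calc _ ≤ profile z τ * Real.exp (-u / 8) * (Real.pi ^ 2 * (40 * Real.exp (u / 8))) := by
        have := profile_nonneg z hτ
        gcongr
        exact h2.trans (by gcongr)
    _ = 40 * Real.pi ^ 2 * profile z τ * (Real.exp (-u / 8) * Real.exp (u / 8)) := by ring
    _ = _ := by rw [← Real.exp_add]; ring_nf; simp

lemma euclNorm_nonneg {N : ℕ} (p : RN N) : 0 ≤ euclNorm p := Real.sqrt_nonneg _

lemma abs_dotp_le {N : ℕ} (p q : RN N) : |dotp p q| ≤ euclNorm p * euclNorm q := by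
  unfold dotp euclNorm
  rw [← Real.sqrt_mul (Finset.sum_nonneg fun i _ => sq_nonneg _)]
  exact Real.abs_le_sqrt (Finset.sum_mul_sq_le_sq_mul_sq _ _ _)

lemma euclNorm_grad_cutGauss_le {N : ℕ} {ε : ℝ} (hε : 0 < ε) (x y : RN N) {τ : ℝ} (hτ : 0 < τ) :
    euclNorm (grad (fun y => cutGauss ε (x - y) τ) y)
      ≤ τ ^ (-(1 / 2 : ℝ)) * profile (x - y) τ := by
  set z := x - y with hz
  have hd := torusSq_nonneg z
  have hK := torusGauss_nonneg z hτ
  have hP := profile_nonneg z hτ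
  set u := torusSq z / τ with hu
  have hu0 : 0 ≤ u := by positivity
  unfold euclNorm
  apply Real.sqrt_le_iff.2
  refine ⟨by positivity, ?_⟩
  have e1 : ∑ i, grad (fun y => cutGauss ε (x - y) τ) y i ^ 2
      = cutGauss ε z τ ^ 2 * (∑ i, circleSqDeriv (z i) ^ 2) / (16 * τ ^ 2) := by
    rw [Finset.mul_sum, Finset.sum_div]
    refine Finset.sum_congr rfl fun i _ => ?_
    unfold grad
    rw [pd_cutGauss_sub, ← hz]
    field_simp
    ring
  have e2 : ∑ i, circleSqDeriv (z i) ^ 2 ≤ 4 * torusSq z := by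
    unfold torusSq
    rw [Finset.mul_sum]
    refine Finset.sum_le_sum fun i _ => ?_
    rw [circleSqDeriv_sq]
    have : 0 ≤ 4 * Real.pi ^ 2 * circleSq (z i) ^ 2 := by positivity
    linarith
  have e3 : (τ ^ (-(1 / 2 : ℝ))) ^ 2 = τ⁻¹ := by
    rw [← Real.rpow_natCast, ← Real.rpow_mul hτ.le, ← Real.rpow_neg_one]
    norm_num
  have e4 : u ≤ 4 * Real.exp (u / 4) := by
    have := Real.add_one_le_exp (u / 4)
    linarith
  rw [e1, mul_pow, e3]
  calc _ ≤ torusGauss z τ ^ 2 * (4 * torusSq z) / (16 * τ ^ 2) := by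
        gcongr
        · exact cutGauss_nonneg hε _ _
        · exact cutGauss_le ε z hτ
    _ = τ⁻¹ * (profile z τ ^ 2 * (Real.exp (-u / 8) ^ 2 * (u / 4))) := by
        rw [torusGauss_eq z hτ, ← hu, hu]; field_simp; ring
    _ ≤ τ⁻¹ * (profile z τ ^ 2 * (Real.exp (-u / 8) ^ 2 * Real.exp (u / 4))) := by
        gcongr; linarith
    _ = _ := by
        rw [← Real.exp_nat_mul, ← Real.exp_add]
        have : ((2 : ℕ) : ℝ) * (-u / 8) + u / 4 = 0 := by push_cast; ring
        rw [this, Real.exp_zero, mul_one]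

lemma circleSq_sub_int (z : ℝ) (k : ℤ) : circleSq (z - k) = circleSq z := by
  unfold circleSq
  rw [mul_sub, mul_comm Real.pi (k : ℝ), Real.sin_sub_int_mul_pi, mul_pow, ← zpow_natCast,
    ← zpow_mul, mul_comm k, zpow_mul]
  simp

lemma isTest_cutGauss {N : ℕ} {ε : ℝ} (hε : 0 < ε) (x : RN N) (t : ℝ) :
    IsTest N fun y s => cutGauss ε (x - y) (t - s) := by
  constructor
  · exact (contDiff_cutGauss hε).comp
      (g := fun q : RN N × ℝ => cutGauss ε q.1 q.2)
      (f := fun q : RN N × ℝ => (x - q.1, t - q.2)) (by fun_prop)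
  · intro s y k
    have : torusSq (x - fun i => y i + (k i : ℝ)) = torusSq (x - y) := by
      unfold torusSq
      refine Finset.sum_congr rfl fun i _ => ?_
      rw [← circleSq_sub_int ((x - y) i) (k i)]
      congr 1
      simp only [Pi.sub_apply]
      ring
    simp only [cutGauss, torusGauss, this]

lemma isCompact_cube (N : ℕ) : IsCompact (cube N) := isCompact_Icc

lemma IsTest.continuous_slice {N : ℕ} {φ : RN N → ℝ → ℝ} (h : IsTest N φ) (t : ℝ) :
    Continuous fun x => φ x t :=
  h.1.continuous.comp (by fun_prop : Continuous fun x : RN N => (x, t))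

lemma IsTest.differentiable_time {N : ℕ} {φ : RN N → ℝ → ℝ} (h : IsTest N φ) (x : RN N) :
    Differentiable ℝ (φ x) :=
  (h.1.comp (contDiff_const.prodMk contDiff_id :
    ContDiff ℝ (⊤ : ℕ∞) fun t : ℝ => (x, t))).differentiable (by simp)

lemma IsTest.add_time {N : ℕ} {φ : RN N → ℝ → ℝ} (h : IsTest N φ) {η : ℝ → ℝ}
    (hη : ContDiff ℝ (⊤ : ℕ∞) η) : IsTest N fun x t => φ x t + η t := by
  refine ⟨h.1.add (hη.comp contDiff_snd), fun t x k => ?_⟩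
  simp only [h.2 t x k]

/-- The integrand of the weak formulation of the Fokker–Planck equation. -/
def weakIntegrand {N : ℕ} (m : RN N → ℝ → ℝ) (A : RN N → ℝ → RN N) (φ : RN N → ℝ → ℝ)
    (q : RN N × ℝ) : ℝ :=
  m q.1 q.2 * (deriv (φ q.1) q.2 + lap (fun y => φ y q.2) q.1
    + dotp (A q.1 q.2) (grad (fun y => φ y q.2) q.1))

lemma pd_add_const {N : ℕ} (i : Fin N) (u : RN N → ℝ) (c : ℝ) :
    pd i (fun y => u y + c) = pd i u := by
  funext x
  simp [pd]

lemma weakIntegrand_add_time {N : ℕ} {m : RN N → ℝ → ℝ} {A : RN N → ℝ → RN N}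
    {φ : RN N → ℝ → ℝ} (h : IsTest N φ) {η : ℝ → ℝ} (hη : ContDiff ℝ (⊤ : ℕ∞) η)
    (q : RN N × ℝ) :
    weakIntegrand m A (fun x t => φ x t + η t) q
      = weakIntegrand m A φ q + m q.1 q.2 * deriv η q.2 := by
  have hg : grad (fun y => φ y q.2 + η q.2) q.1 = grad (fun y => φ y q.2) q.1 := by
    funext i
    simp only [grad, pd_add_const]
  have hd : deriv (fun t => φ q.1 t + η t) q.2 = deriv (φ q.1) q.2 + deriv η q.2 :=
    deriv_fun_add (h.differentiable_time q.1 q.2) (hη.differentiable (by simp) q.2)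
  simp only [weakIntegrand, hg, hd, lap, pd_add_const]
  ring

section FokkerPlanck

variable {N : ℕ} {T γ' K₀ : ℝ} {m₀ : RN N → ℝ} {m : RN N → ℝ → ℝ} {A : RN N → ℝ → RN N}

lemma FPSol.integrable_weakIntegrand (hT : 0 < T) (hd : FPData N K₀ m₀)
    (hs : FPSol N T γ' m₀ m A) {φ : RN N → ℝ → ℝ} (hφ : IsTest N φ) (hφT : ∀ x, φ x T = 0) :
    Integrable (weakIntegrand m A φ) (cylMeasure N T) := by
  by_contra hI
  set η : ℝ → ℝ := fun t => T - t with hη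
  have hηs : ContDiff ℝ (⊤ : ℕ∞) η := contDiff_const.sub contDiff_id
  have hη' : ∀ t, deriv η t = -1 := fun t => by simp [hη]
  have hw1 := hs.weak φ hφ hφT
  have hw2 := hs.weak (fun x t => φ x t + η t) (hφ.add_time hηs) (by simp [hφT, hη])
  have e1 : intQ N T (fun x t => m x t * (deriv (φ x) t + lap (fun y => φ y t) x
        + dotp (A x t) (grad (fun y => φ y t) x))) = 0 := integral_undef hI
  have hI2 : ¬ Integrable (weakIntegrand m A fun x t => φ x t + η t) (cylMeasure N T) := by
    intro h
    apply hI
    have := h.add hs.int_m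
    refine this.congr (Eventually.of_forall fun q => ?_)
    simp only [Pi.add_apply, weakIntegrand_add_time hφ hηs, hη']
    ring
  have e2 : intQ N T (fun x t => m x t * (deriv (fun t => φ x t + η t) t
      + lap (fun y => φ y t + η t) x
        + dotp (A x t) (grad (fun y => φ y t + η t) x))) = 0 := integral_undef hI2
  rw [e1, zero_add] at hw1
  rw [e2, zero_add] at hw2
  have hc0 : Continuous m₀ := hd.2.2.2.1.continuous
  have i1 : IntegrableOn (fun x => m₀ x * φ x 0) (cube N) :=
    (hc0.mul (hφ.continuous_slice 0)).continuousOn.integrableOn_compact (isCompact_cube N)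
  have i2 : IntegrableOn (fun x => m₀ x * η 0) (cube N) :=
    (hc0.mul continuous_const).continuousOn.integrableOn_compact (isCompact_cube N)
  simp only [mul_add] at hw2
  rw [integral_add i1 i2, hw1, integral_mul_const, hd.2.2.1] at hw2
  simp [hη] at hw2
  exact hT.ne' hw2

lemma FPSol.integral_weakIntegrand (hs : FPSol N T γ' m₀ m A) {φ : RN N → ℝ → ℝ}
    (hφ : IsTest N φ) (hφT : ∀ x, φ x T = 0) :
    ∫ q, weakIntegrand m A φ q ∂(cylMeasure N T) = -∫ x in cube N, m₀ x * φ x 0 :=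
  eq_neg_of_add_eq_zero_left (hs.weak φ hφ hφT)

lemma FPData.le_const (hd : FPData N K₀ m₀) {x : RN N} (hx : x ∈ cube N) :
    m₀ x ≤ 1 + N * K₀ := by
  obtain ⟨-, h0, h1, hdiff, hg⟩ := hd
  have hc0 : Continuous m₀ := hdiff.continuous
  obtain ⟨y, hy, hy1⟩ : ∃ y ∈ cube N, m₀ y ≤ 1 := by
    have := exists_le_setAverage (μ := volume) (s := cube N) (f := m₀)
      (by rw [volume_cube]; simp) (by rw [volume_cube]; simp)
      (hc0.continuousOn.integrableOn_compact (isCompact_cube N))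
    rw [setAverage_eq, h1] at this
    simpa [Measure.real, volume_cube] using this
  have hK : 0 ≤ K₀ := (euclNorm_nonneg _).trans (hg 0)
  have hb : ∀ z, ‖fderiv ℝ m₀ z‖ ≤ N * K₀ := by
    intro z
    refine ContinuousLinearMap.opNorm_le_bound _ (by positivity) fun v => ?_
    have e : fderiv ℝ m₀ z v = ∑ i, v i * grad m₀ z i := by
      conv_lhs => rw [pi_eq_sum_univ' v]
      simp [map_sum, grad, pd]
    rw [e]
    calc _ ≤ ∑ i, ‖v i * grad m₀ z i‖ := norm_sum_le _ _
      _ ≤ ∑ _i : Fin N, ‖v‖ * K₀ := by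
          refine Finset.sum_le_sum fun i _ => ?_
          rw [norm_mul]
          gcongr
          · exact norm_le_pi_norm v i
          · refine le_trans ?_ (hg z)
            refine Real.abs_le_sqrt ?_
            exact Finset.single_le_sum (f := fun i => grad m₀ z i ^ 2)
              (fun j _ => sq_nonneg _) (Finset.mem_univ i)
      _ = _ := by simp; ring
  have h2 := Convex.norm_image_sub_le_of_norm_fderiv_le (𝕜 := ℝ) (f := m₀) (s := univ)
    (C := N * K₀) (x := y) (y := x) (fun z _ => hdiff z) (fun z _ => hb z) convex_univ
    (mem_univ _) (mem_univ _)
  have h3 : ‖x - y‖ ≤ 1 := by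
    rw [pi_norm_le_iff_of_nonneg zero_le_one]
    intro i
    have a1 := hx.1 i; have a2 := hx.2 i; have a3 := hy.1 i; have a4 := hy.2 i
    simp only [Pi.zero_apply, Pi.one_apply] at a1 a2 a3 a4
    rw [Pi.sub_apply, Real.norm_eq_abs, abs_le]
    constructor <;> linarith
  have h4 : N * K₀ * ‖x - y‖ ≤ N * K₀ := mul_le_of_le_one_right (by positivity) h3
  rw [Real.norm_eq_abs] at h2
  have := le_abs_self (m₀ x - m₀ y)
  linarith

lemma FPSol.lintegral_defect_le (hT : 0 < T) (hd : FPData N K₀ m₀)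
    (hs : FPSol N T γ' m₀ m A) {ε : ℝ} (hε : 0 < ε) {x : RN N} {t : ℝ} (hx : (x, t) ∈ QQ N T) :
    ∫⁻ q, ENNReal.ofReal (m q.1 q.2 * (deriv (timeCut ε) (t - q.2) * torusGauss (x - q.1) (t - q.2)))
        ∂(cylMeasure N T)
      ≤ ENNReal.ofReal ((1 + N * K₀) * profileMass N) +
        ENNReal.ofReal (1 + 40 * Real.pi ^ 2 * √T) *
        ∫⁻ q, heatKer T (1 / 2) (x, t) q * ENNReal.ofReal ((1 + euclNorm (A q.1 q.2)) * m q.1 q.2)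
          ∂(cylMeasure N T) := by
  obtain ⟨hx, ht⟩ := hx
  simp only at hx ht
  set φ : RN N → ℝ → ℝ := fun y s => cutGauss ε (x - y) (t - s) with hφ
  have hφt : IsTest N φ := isTest_cutGauss hε x t
  have hφT : ∀ y, φ y T = 0 := fun y => cutGauss_eq_zero hε _ (by linarith [ht.2])
  have hI := hs.integrable_weakIntegrand hT hd hφt hφT
  have hIe := hs.integral_weakIntegrand hφt hφT
  set I := weakIntegrand m A φ with hIdef
  set β : RN N × ℝ → ℝ := fun q =>
    m q.1 q.2 * (deriv (timeCut ε) (t - q.2) * torusGauss (x - q.1) (t - q.2)) with hβ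
  set c : ℝ := 1 + 40 * Real.pi ^ 2 * √T with hc
  set R : RN N × ℝ → ENNReal := fun q => heatKer T (1 / 2) (x, t) q *
    ENNReal.ofReal ((1 + euclNorm (A q.1 q.2)) * m q.1 q.2) with hR
  have hK0 : 0 ≤ K₀ := (euclNorm_nonneg _).trans (hd.2.2.2.2 0)
  have hpt : ∀ q ∈ QQ N T, ENNReal.ofReal (β q) + ENNReal.ofReal (I q)
      ≤ ENNReal.ofReal (-I q) + ENNReal.ofReal c * R q := by
    rintro ⟨y, s⟩ ⟨hy, hs'⟩
    simp only at hy hs'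
    have hm0 := hs.nonneg y s
    have hIq : I (y, s) = -β (y, s) + m y s * (-(cutGauss ε (x - y) (t - s) *
        heatDefect (x - y) (t - s)) + dotp (A y s) (grad (fun y => φ y s) y)) := by
      simp only [hIdef, weakIntegrand, hφ, deriv_add_lap_cutGauss hε, hβ]
      ring
    rcases lt_or_ge (t - s) ε with h | h
    · have hz : ∀ y', cutGauss ε (x - y') (t - s) = 0 := fun y' => cutGauss_eq_zero hε _ h.le
      have hg : grad (fun y => φ y s) y = 0 := by
        funext i
        simp [grad, pd, hφ, hz]
      have hb0 : β (y, s) = 0 := by simp [hβ, deriv_timeCut_eq_zero hε h]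
      rw [hIq, hb0, hz, hg]
      simp [dotp]
    have hτ : 0 < t - s := hε.trans_le h
    have hτT : t - s < T := by linarith [ht.2, hs'.1]
    have hβ0 : 0 ≤ β (y, s) :=
      mul_nonneg hm0 (mul_nonneg (deriv_timeCut_nonneg hε _) (torusGauss_nonneg _ hτ))
    set P := profile (x - y) (t - s) with hP
    have hP0 : 0 ≤ P := profile_nonneg _ hτ
    set k := (t - s) ^ (-(1 / 2 : ℝ)) * P with hk
    have hk0 : 0 ≤ k := by positivity
    have hRq : ENNReal.ofReal c * R (y, s)
        = ENNReal.ofReal (c * (k * ((1 + euclNorm (A y s)) * m y s))) := by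
      have : heatKer T (1 / 2) (x, t) (y, s) = ENNReal.ofReal k := by
        unfold heatKer
        rw [indicator_of_mem (show t - s ∈ Ioo 0 T from ⟨hτ, hτT⟩)]
      simp only [hR, this]
      rw [← ENNReal.ofReal_mul hk0, ← ENNReal.ofReal_mul (by positivity)]
    have hPk : P ≤ √T * k := by
      have : 1 ≤ √T * (t - s) ^ (-(1 / 2 : ℝ)) := by
        rw [Real.rpow_neg hτ.le, ← Real.sqrt_eq_rpow, ← div_eq_mul_inv,
          one_le_div (Real.sqrt_pos.2 hτ)]
        exact Real.sqrt_le_sqrt hτT.le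
      calc P = 1 * P := (one_mul P).symm
        _ ≤ √T * (t - s) ^ (-(1 / 2 : ℝ)) * P := by gcongr
        _ = _ := by rw [hk]; ring
    have hdef : |cutGauss ε (x - y) (t - s) * heatDefect (x - y) (t - s)|
        ≤ 40 * Real.pi ^ 2 * (√T * k) := by
      rw [abs_mul, abs_of_nonneg (cutGauss_nonneg hε _ _)]
      calc _ ≤ torusGauss (x - y) (t - s) * |heatDefect (x - y) (t - s)| := by
            gcongr; exact cutGauss_le ε _ hτ
        _ ≤ 40 * Real.pi ^ 2 * P := abs_heatDefect_mul_le _ hτ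
        _ ≤ _ := by gcongr
    have hgr : |dotp (A y s) (grad (fun y => φ y s) y)| ≤ euclNorm (A y s) * k :=
      (abs_dotp_le _ _).trans (mul_le_mul_of_nonneg_left
        (euclNorm_grad_cutGauss_le hε x y hτ) (euclNorm_nonneg _))
    have hA0 := euclNorm_nonneg (A y s)
    have hmain : β (y, s) ≤ -I (y, s) + c * (k * ((1 + euclNorm (A y s)) * m y s)) := by
      have h1 : -(cutGauss ε (x - y) (t - s) * heatDefect (x - y) (t - s))
          + dotp (A y s) (grad (fun y => φ y s) y) ≤ c * (k * (1 + euclNorm (A y s))) := by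
        have a1 := neg_abs_le (cutGauss ε (x - y) (t - s) * heatDefect (x - y) (t - s))
        have a2 := le_abs_self (dotp (A y s) (grad (fun y => φ y s) y))
        have a3 : 0 ≤ 40 * Real.pi ^ 2 * √T * k * euclNorm (A y s) := by positivity
        rw [hc]
        nlinarith
      have h2 := mul_le_mul_of_nonneg_left h1 hm0
      rw [hIq]
      linarith
    have hnn : 0 ≤ c * (k * ((1 + euclNorm (A y s)) * m y s)) := by positivity
    rw [hRq]
    rcases le_total 0 (I (y, s)) with hI0 | hI0
    · rw [← ENNReal.ofReal_add hβ0 hI0, ENNReal.ofReal_of_nonpos (neg_nonpos.2 hI0), zero_add]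
      exact ENNReal.ofReal_le_ofReal (by linarith)
    · rw [ENNReal.ofReal_of_nonpos hI0, add_zero, ← ENNReal.ofReal_add (by linarith) hnn]
      exact ENNReal.ofReal_le_ofReal hmain
  have hImeas : AEMeasurable (fun q => ENNReal.ofReal (I q)) (cylMeasure N T) :=
    hI.aestronglyMeasurable.aemeasurable.ennreal_ofReal
  have hImeas' : AEMeasurable (fun q => ENNReal.ofReal (-I q)) (cylMeasure N T) :=
    hI.aestronglyMeasurable.aemeasurable.neg.ennreal_ofReal
  have hsum : (∫⁻ q, ENNReal.ofReal (β q) ∂(cylMeasure N T)) +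
        ∫⁻ q, ENNReal.ofReal (I q) ∂(cylMeasure N T)
      ≤ (∫⁻ q, ENNReal.ofReal (-I q) ∂(cylMeasure N T)) +
        ENNReal.ofReal c * ∫⁻ q, R q ∂(cylMeasure N T) := by
    rw [← lintegral_add_right' _ hImeas, ← lintegral_const_mul' _ _ ENNReal.ofReal_ne_top,
      ← lintegral_add_left' hImeas']
    refine lintegral_mono_ae ?_
    filter_upwards [ae_restrict_mem (measurableSet_QQ N T)] with q hq using hpt q hq
  have hposfin : ∫⁻ q, ENNReal.ofReal (I q) ∂(cylMeasure N T) ≠ ⊤ :=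
    ((lintegral_ofReal_le_lintegral_enorm I).trans_lt hI.2).ne
  have hnegfin : ∫⁻ q, ENNReal.ofReal (-I q) ∂(cylMeasure N T) ≠ ⊤ :=
    ((lintegral_ofReal_le_lintegral_enorm _).trans_lt hI.neg.2).ne
  have hc0 : Continuous m₀ := hd.2.2.2.1.continuous
  have i1 : IntegrableOn (fun y => m₀ y * φ y 0) (cube N) :=
    (hc0.mul (hφt.continuous_slice 0)).continuousOn.integrableOn_compact (isCompact_cube N)
  have hφ0 : ∀ y, 0 ≤ m₀ y * φ y 0 := fun y => mul_nonneg (hd.2.1 y) (cutGauss_nonneg hε _ _)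
  have hneg : ∫⁻ q, ENNReal.ofReal (-I q) ∂(cylMeasure N T)
      = (∫⁻ q, ENNReal.ofReal (I q) ∂(cylMeasure N T)) +
        ∫⁻ y in cube N, ENNReal.ofReal (m₀ y * φ y 0) := by
    rw [← ofReal_integral_eq_lintegral_ofReal i1 (Eventually.of_forall hφ0)]
    rw [integral_eq_lintegral_pos_part_sub_lintegral_neg_part hI] at hIe
    rw [← ENNReal.ofReal_toReal hnegfin, ← ENNReal.ofReal_toReal hposfin,
      ← ENNReal.ofReal_add ENNReal.toReal_nonneg (integral_nonneg hφ0)]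
    congr 1
    linarith
  have hini : ∫⁻ y in cube N, ENNReal.ofReal (m₀ y * φ y 0)
      ≤ ENNReal.ofReal ((1 + N * K₀) * profileMass N) := by
    calc _ ≤ ∫⁻ y in cube N, ENNReal.ofReal (1 + N * K₀) * ENNReal.ofReal (profile (x - y) t) := by
          refine setLIntegral_mono' (measurableSet_cube N) fun y hy => ?_
          rw [← ENNReal.ofReal_mul (by positivity)]
          apply ENNReal.ofReal_le_ofReal
          have e : φ y 0 = cutGauss ε (x - y) t := by simp [hφ]
          rw [e]
          have := (cutGauss_le ε (x - y) ht.1).trans (torusGauss_le_profile (x - y) ht.1)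
          exact mul_le_mul (hd.le_const hy) this (cutGauss_nonneg hε _ _) (by positivity)
      _ = ENNReal.ofReal (1 + N * K₀) * ∫⁻ y in cube N, ENNReal.ofReal (profile (x - y) t) :=
          lintegral_const_mul' _ _ ENNReal.ofReal_ne_top
      _ ≤ ENNReal.ofReal (1 + N * K₀) * ENNReal.ofReal (profileMass N) := by
          gcongr; exact lintegral_profile_le hx ht.1
      _ = _ := (ENNReal.ofReal_mul (by positivity)).symm
  rw [hneg, add_comm, add_assoc] at hsum
  refine ((ENNReal.add_le_add_iff_left hposfin).1 hsum).trans ?_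
  gcongr

end FokkerPlanck

/-- The kernel produced by the time derivative of the cutoff in `cutGauss`, an approximation
of the Dirac mass on the diagonal. -/
def cutKer {N : ℕ} (ε : ℝ) (q q' : RN N × ℝ) : ENNReal :=
  ENNReal.ofReal (deriv (timeCut ε) (q.2 - q'.2) * torusGauss (q.1 - q'.1) (q.2 - q'.2))

lemma measurable_torusGauss {N : ℕ} : Measurable fun p : RN N × ℝ => torusGauss p.1 p.2 := by
  unfold torusGauss
  have := (continuous_torusSq (N := N)).measurable
  fun_prop

lemma continuous_deriv_timeCut (ε : ℝ) : Continuous (deriv (timeCut ε)) :=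
  (contDiff_timeCut ε).continuous_deriv (by simp)

lemma measurable_cutKer {N : ℕ} (ε : ℝ) :
    Measurable fun p : (RN N × ℝ) × (RN N × ℝ) => cutKer ε p.1 p.2 := by
  unfold cutKer
  have h1 := (continuous_deriv_timeCut ε).measurable
  have h2 := (measurable_torusGauss (N := N)).comp
    (by fun_prop : Measurable fun p : (RN N × ℝ) × (RN N × ℝ) => (p.1.1 - p.2.1, p.1.2 - p.2.2))
  exact ((h1.comp (by fun_prop)).mul h2).ennreal_ofReal

lemma measurable_cutKer_left {N : ℕ} (ε : ℝ) (q' : RN N × ℝ) :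
    Measurable fun q => cutKer ε q q' :=
  Measurable.of_uncurry_right (f := cutKer ε) (measurable_cutKer ε)

lemma ofReal_one_add_mul_le {a b γ' : ℝ} (ha : 0 ≤ a) (hb : 0 ≤ b) (hγ' : 1 < γ') :
    ENNReal.ofReal ((1 + a) * b) ≤ 2 * ((ENNReal.ofReal (a ^ γ' * b) + ENNReal.ofReal b) ^ (1 / γ')
      * ENNReal.ofReal b ^ (1 - 1 / γ')) := by
  have hγ0 : 0 < γ' := by linarith
  have hu0 : 0 ≤ 1 / γ' := by positivity
  have hu1 : 0 ≤ 1 - 1 / γ' := by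
    rw [sub_nonneg, div_le_one hγ0]; exact hγ'.le
  set u := 1 / γ' with hu
  set Z := ENNReal.ofReal (a ^ γ' * b) + ENNReal.ofReal b
  have key : ENNReal.ofReal b = ENNReal.ofReal b ^ u * ENNReal.ofReal b ^ (1 - u) := by
    rw [← ENNReal.rpow_add_of_nonneg _ _ hu0 hu1]
    simp
  have h1 : ENNReal.ofReal b ≤ Z ^ u * ENNReal.ofReal b ^ (1 - u) := by
    conv_lhs => rw [key]
    gcongr
    exact le_add_self
  have h2 : ENNReal.ofReal (a * b) ≤ Z ^ u * ENNReal.ofReal b ^ (1 - u) := by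
    rw [ENNReal.ofReal_mul ha]
    conv_lhs => rw [key, ← mul_assoc]
    gcongr
    have : ENNReal.ofReal a = ENNReal.ofReal (a ^ γ') ^ u := by
      rw [← ENNReal.ofReal_rpow_of_nonneg ha hγ0.le, ← ENNReal.rpow_mul, hu,
        mul_one_div_cancel hγ0.ne', ENNReal.rpow_one]
    rw [this, ← ENNReal.mul_rpow_of_nonneg _ _ hu0, ← ENNReal.ofReal_mul (by positivity)]
    gcongr
    exact le_self_add
  rw [add_mul, one_mul, ENNReal.ofReal_add hb (by positivity), two_mul]
  exact add_le_add h1 h2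

lemma FPSol.lintegral_cutKer_le {N : ℕ} {T γ' K₀ : ℝ} {m₀ : RN N → ℝ} {m : RN N → ℝ → ℝ}
    {A : RN N → ℝ → RN N} (hT : 0 < T) (hγ' : 1 < γ') (hd : FPData N K₀ m₀)
    (hs : FPSol N T γ' m₀ m A) {M Z : RN N × ℝ → ENNReal}
    (hM : M =ᵐ[cylMeasure N T] fun q => ENNReal.ofReal (m q.1 q.2))
    (hZ : Z =ᵐ[cylMeasure N T] fun q =>
      ENNReal.ofReal (euclNorm (A q.1 q.2) ^ γ' * m q.1 q.2) + ENNReal.ofReal (m q.1 q.2))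
    {ε : ℝ} (hε : 0 < ε) {q : RN N × ℝ} (hq : q ∈ QQ N T) :
    ∫⁻ q', cutKer ε q q' * M q' ∂(cylMeasure N T)
      ≤ ENNReal.ofReal ((1 + N * K₀) * profileMass N) +
        2 * ENNReal.ofReal (1 + 40 * Real.pi ^ 2 * √T) *
          heatOp T (1 / 2) (fun q => Z q ^ (1 / γ') * M q ^ (1 - 1 / γ')) q := by
  have h1 : ∫⁻ q', cutKer ε q q' * M q' ∂(cylMeasure N T) = ∫⁻ q', ENNReal.ofReal (m q'.1 q'.2 *
      (deriv (timeCut ε) (q.2 - q'.2) * torusGauss (q.1 - q'.1) (q.2 - q'.2)))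
        ∂(cylMeasure N T) := by
    refine lintegral_congr_ae ?_
    filter_upwards [hM] with q' hq'
    rw [hq', ENNReal.ofReal_mul (hs.nonneg _ _), mul_comm, cutKer]
  rw [h1]
  refine (hs.lintegral_defect_le hT hd hε hq).trans ?_
  rw [mul_comm 2 (ENNReal.ofReal _), mul_assoc (ENNReal.ofReal _) 2, heatOp,
    ← lintegral_const_mul' 2 _ (by simp)]
  refine add_le_add_right (mul_le_mul_right (lintegral_mono_ae ?_) _) _
  filter_upwards [hM, hZ] with q' hMq hZq
  rw [mul_left_comm, hMq, hZq]
  gcongr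
  exact ofReal_one_add_mul_le (euclNorm_nonneg _) (hs.nonneg _ _) hγ'

lemma lintegral_deriv_timeCut {ε : ℝ} (hε : 0 < ε) (s : ℝ) :
    ∫⁻ t in Ioc (s + ε) (s + 2 * ε), ENNReal.ofReal (deriv (timeCut ε) (t - s)) = 1 := by
  have hc : Continuous fun t => deriv (timeCut ε) (t - s) :=
    (continuous_deriv_timeCut ε).comp (by fun_prop)
  have hle : s + ε ≤ s + 2 * ε := by linarith
  rw [← ofReal_integral_eq_lintegral_ofReal (hc.integrableOn_Ioc)
    (Eventually.of_forall fun t => deriv_timeCut_nonneg hε _),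
    ← intervalIntegral.integral_of_le hle,
    intervalIntegral.integral_eq_sub_of_hasDerivAt (f := fun t => timeCut ε (t - s))
      (fun t _ => (hasDerivAt_timeCut ε (t - s)).comp_sub_const t s) (hc.intervalIntegrable _ _),
    timeCut_eq_one hε (by linarith), timeCut_eq_zero hε (by linarith)]
  simp

lemma circleSq_le (z : ℝ) : circleSq z ≤ z ^ 2 := by
  have hπ := Real.pi_pos
  unfold circleSq
  rw [div_le_iff₀ (by positivity), ← mul_pow, mul_comm z]
  exact sq_le_sq.2 Real.abs_sin_le_abs

lemma torusGauss_ge {N : ℕ} {z : RN N} {ε τ : ℝ} (hε : 0 < ε) (h1 : ε ≤ τ) (h2 : τ ≤ 2 * ε)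
    (hz : ‖z‖ ≤ √ε) :
    Real.exp (-((N : ℝ) / 4)) * (2 * ε) ^ (-((N : ℝ) / 2)) ≤ torusGauss z τ := by
  have hτ : 0 < τ := hε.trans_le h1
  unfold torusGauss
  rw [mul_comm]
  have hsum : torusSq z ≤ N * τ := by
    calc torusSq z ≤ ∑ _i : Fin N, τ := by
          refine Finset.sum_le_sum fun i _ => (circleSq_le _).trans (le_trans ?_ h1)
          have := (norm_le_pi_norm z i).trans hz
          rw [Real.norm_eq_abs] at this
          rw [← sq_abs]
          calc |z i| ^ 2 ≤ √ε ^ 2 := by gcongr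
            _ = ε := Real.sq_sqrt hε.le
      _ = N * τ := by simp
  refine mul_le_mul ?_ ?_ (by positivity) (by positivity)
  · exact Real.rpow_le_rpow_of_nonpos hτ h2 (by simp; positivity)
  · apply Real.exp_le_exp.2
    rw [neg_div, neg_le_neg_iff, div_le_div_iff₀ (by positivity) (by positivity)]
    linarith

lemma le_lintegral_cutKer {N : ℕ} {V : Set (RN N × ℝ)} (hV : IsOpen V)
    {q' : RN N × ℝ} (hq' : q' ∈ V) :
    ∀ᶠ ε in 𝓝[>] (0 : ℝ),
      ENNReal.ofReal (Real.exp (-((N : ℝ) / 4))) ≤ ∫⁻ q in V, cutKer ε q q' := by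
  obtain ⟨r, hr, hrV⟩ := Metric.isOpen_iff.1 hV q' hq'
  have hlim : Tendsto (fun ε : ℝ => √ε) (𝓝[>] 0) (𝓝 0) := by
    have := (Real.continuous_sqrt.tendsto 0).mono_left (nhdsWithin_le_nhds (s := Ioi 0))
    simpa using this
  have hlim2 : Tendsto (fun ε : ℝ => 2 * ε) (𝓝[>] 0) (𝓝 0) := by
    have := ((continuous_const.mul continuous_id).tendsto (0:ℝ)).mono_left
      (nhdsWithin_le_nhds (s := Ioi 0)) (f := fun ε : ℝ => 2 * ε)
    simpa using this
  filter_upwards [self_mem_nhdsWithin, hlim.eventually (gt_mem_nhds hr),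
    hlim2.eventually (gt_mem_nhds hr)] with ε hε h1 h2
  have hε : 0 < ε := hε
  obtain ⟨y, s⟩ := q'
  set B : Set (RN N × ℝ) := Metric.closedBall y √ε ×ˢ Ioc (s + ε) (s + 2 * ε) with hB
  have hBV : B ⊆ V := by
    rintro ⟨x, t⟩ ⟨hx, ht⟩
    apply hrV
    rw [Metric.mem_ball, Prod.dist_eq, max_lt_iff]
    refine ⟨lt_of_le_of_lt hx h1, ?_⟩
    simp only [Real.dist_eq]
    rw [abs_of_pos (by linarith [ht.1])]
    linarith [ht.2]
  set k := Real.exp (-((N : ℝ) / 4)) * (2 * ε) ^ (-((N : ℝ) / 2)) with hk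
  have hk0 : 0 ≤ k := by positivity
  have hBm : MeasurableSet B := measurableSet_closedBall.prod measurableSet_Ioc
  calc ENNReal.ofReal (Real.exp (-((N : ℝ) / 4)))
      ≤ ENNReal.ofReal (k * (2 * √ε) ^ N) := by
        apply ENNReal.ofReal_le_ofReal
        rw [hk, mul_assoc]
        refine le_mul_of_one_le_right (by positivity) ?_
        have e : (2 * √ε) ^ N = (4 * ε) ^ ((N : ℝ) / 2) := by
          have : 2 * √ε = √(4 * ε) := by
            rw [Real.sqrt_mul (by norm_num)]
            congr 1
            rw [show (4 : ℝ) = 2 ^ 2 by norm_num, Real.sqrt_sq (by norm_num)]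
          rw [this, Real.sqrt_eq_rpow, ← Real.rpow_natCast, ← Real.rpow_mul (by positivity)]
          congr 1
          ring
        rw [e, Real.rpow_neg (by positivity), ← div_eq_inv_mul, one_le_div (by positivity)]
        gcongr
        norm_num
    _ = ∫⁻ q in B, ENNReal.ofReal k * ENNReal.ofReal (deriv (timeCut ε) (q.2 - s)) := by
        have hm : Measurable fun t => ENNReal.ofReal (deriv (timeCut ε) (t - s)) :=
          ((continuous_deriv_timeCut ε).comp (by fun_prop)).measurable.ennreal_ofReal
        rw [hB, Measure.volume_eq_prod, ← Measure.prod_restrict,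
          lintegral_prod_mul (f := fun _ : RN N => ENNReal.ofReal k) (by fun_prop) hm.aemeasurable,
          lintegral_deriv_timeCut hε, mul_one, setLIntegral_const,
          Real.volume_pi_closedBall _ (by positivity), Fintype.card_fin, ENNReal.ofReal_mul hk0]
    _ ≤ ∫⁻ q in B, cutKer ε q (y, s) := by
        refine setLIntegral_mono' hBm ?_
        rintro ⟨x, t⟩ ⟨hx, ht⟩
        simp only at hx ht
        rw [cutKer, ← ENNReal.ofReal_mul hk0, mul_comm]
        apply ENNReal.ofReal_le_ofReal
        refine mul_le_mul_of_nonneg_left ?_ (deriv_timeCut_nonneg hε _)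
        refine torusGauss_ge hε (by simp; linarith [ht.1]) (by simp; linarith [ht.2]) ?_
        simpa [dist_eq_norm] using hx
    _ ≤ ∫⁻ q in V, cutKer ε q (y, s) := lintegral_mono_set hBV

/-- The interior of the cylinder `QQ N T`. -/
def openCyl (N : ℕ) (T : ℝ) : Set (RN N × ℝ) := (univ.pi fun _ => Ioo 0 1) ×ˢ Ioo 0 T

lemma isOpen_openCyl (N : ℕ) (T : ℝ) : IsOpen (openCyl N T) :=
  (isOpen_set_pi finite_univ fun _ _ => isOpen_Ioo).prod isOpen_Ioo

lemma openCyl_subset (N : ℕ) (T : ℝ) : openCyl N T ⊆ QQ N T := by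
  refine prod_mono (fun x hx => ⟨fun i => (hx i trivial).1.le, fun i => (hx i trivial).2.le⟩)
    subset_rfl

lemma restrict_openCyl (N : ℕ) (T : ℝ) :
    (volume : Measure (RN N × ℝ)).restrict (openCyl N T) = cylMeasure N T := by
  rw [cylMeasure_eq_prod, openCyl, Measure.volume_eq_prod, ← Measure.prod_restrict]
  congr 1
  exact Measure.restrict_congr_set (Measure.univ_pi_Ioo_ae_eq_Icc (f := (0 : RN N)) (g := 1))

/-- If all averages of `M` against the kernels `cutKer ε` are bounded by `U`, so is a multiple
of `M`. -/
lemma ae_le_of_lintegral_cutKer_le {N : ℕ} {T : ℝ} {M U : RN N × ℝ → ENNReal}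
    (hM : Measurable M) (hU : Measurable U) (hUfin : ∫⁻ q, U q ∂(cylMeasure N T) ≠ ⊤)
    (h : ∀ ε > 0, ∀ q ∈ QQ N T, ∫⁻ q', cutKer ε q q' * M q' ∂(cylMeasure N T) ≤ U q) :
    ∀ᵐ q ∂(cylMeasure N T), ENNReal.ofReal (Real.exp (-((N : ℝ) / 4))) * M q ≤ U q := by
  set c := ENNReal.ofReal (Real.exp (-((N : ℝ) / 4))) with hc
  have hopen : ∀ V ⊆ openCyl N T, IsOpen V → ∫⁻ q in V, c * M q ≤ ∫⁻ q in V, U q := by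
    intro V hVs hV
    set ε : ℕ → ℝ := fun n => 1 / ((n : ℝ) + 1) with hε
    have hεpos : ∀ n, 0 < ε n := fun n => by positivity
    have hεlim : Tendsto ε atTop (𝓝[>] 0) :=
      tendsto_nhdsWithin_iff.2 ⟨tendsto_one_div_add_atTop_nhds_zero_nat,
        Eventually.of_forall hεpos⟩
    have hjoint : ∀ n, Measurable fun p : (RN N × ℝ) × (RN N × ℝ) =>
        cutKer (ε n) p.1 p.2 * M p.2 := fun n =>
      (measurable_cutKer _).mul (hM.comp measurable_snd)
    have hbound : ∀ n, ∫⁻ q' in V, (∫⁻ q in V, cutKer (ε n) q q') * M q' ≤ ∫⁻ q in V, U q := by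
      intro n
      calc ∫⁻ q' in V, (∫⁻ q in V, cutKer (ε n) q q') * M q'
          = ∫⁻ q' in V, ∫⁻ q in V, cutKer (ε n) q q' * M q' := by
            refine lintegral_congr fun q' => ?_
            rw [lintegral_mul_const _ (measurable_cutKer_left _ q')]
        _ = ∫⁻ q in V, ∫⁻ q' in V, cutKer (ε n) q q' * M q' :=
            (lintegral_lintegral_swap (hjoint n).aemeasurable).symm
        _ ≤ ∫⁻ q in V, U q := by
            refine setLIntegral_mono hU fun q hq => ?_
            refine le_trans ?_ (h (ε n) (hεpos n) q (openCyl_subset N T (hVs hq)))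
            exact lintegral_mono_set (hVs.trans (openCyl_subset N T))
    calc ∫⁻ q in V, c * M q
        ≤ ∫⁻ q' in V, liminf (fun n => (∫⁻ q in V, cutKer (ε n) q q') * M q') atTop := by
          refine setLIntegral_mono' hV.measurableSet fun q' hq' => ?_
          refine le_liminf_of_le (by isBoundedDefault) ?_
          filter_upwards [hεlim.eventually (le_lintegral_cutKer hV hq')] with n hn
          gcongr
      _ ≤ liminf (fun n => ∫⁻ q' in V, (∫⁻ q in V, cutKer (ε n) q q') * M q') atTop := by
          refine lintegral_liminf_le fun n => ?_
          refine Measurable.mul ?_ hM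
          exact Measurable.lintegral_prod_left (measurable_cutKer (ε n))
      _ ≤ ∫⁻ q in V, U q := by
          refine (liminf_le_liminf (Eventually.of_forall hbound)).trans ?_
          simp
  refine ae_le_of_forall_setLIntegral_le_of_sigmaFinite (hM.const_mul c) fun S hS _ => ?_
  have hfin : IsFiniteMeasure ((cylMeasure N T).withDensity U) := isFiniteMeasure_withDensity hUfin
  rw [← withDensity_apply U hS, S.measure_eq_iInf_isOpen]
  refine le_iInf fun O => le_iInf fun hSO => le_iInf fun hO => ?_
  rw [withDensity_apply U hO.measurableSet]
  refine (lintegral_mono_set hSO).trans ?_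
  have := hopen (O ∩ openCyl N T) inter_subset_right (hO.inter (isOpen_openCyl N T))
  rwa [← Measure.restrict_restrict hO.measurableSet, restrict_openCyl] at this

lemma contDiff_intervalIntegral {f : ℝ → ℝ} (hf : ContDiff ℝ (⊤ : ℕ∞) f) (a : ℝ) :
    ContDiff ℝ (⊤ : ℕ∞) fun t => ∫ s in a..t, f s := by
  have hd : ∀ t, HasDerivAt (fun t => ∫ s in a..t, f s) (f t) t := fun t =>
    hf.continuous.integral_hasStrictDerivAt a t |>.hasDerivAt
  rw [contDiff_infty_iff_deriv]
  refine ⟨fun t => (hd t).differentiableAt, ?_⟩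
  rwa [show deriv (fun t => ∫ s in a..t, f s) = f from funext fun t => (hd t).deriv]

section FokkerPlanck

variable {N : ℕ} {T γ' K₀ : ℝ} {m₀ : RN N → ℝ} {m : RN N → ℝ → ℝ} {A : RN N → ℝ → RN N}

lemma FPSol.integral_mul_time (hd : FPData N K₀ m₀) (hs : FPSol N T γ' m₀ m A)
    {ζ : ℝ → ℝ} (hζ : ContDiff ℝ (⊤ : ℕ∞) ζ) :
    ∫ q, m q.1 q.2 * ζ q.2 ∂(cylMeasure N T) = ∫ t in (0 : ℝ)..T, ζ t := by
  set η : ℝ → ℝ := fun t => ∫ s in T..t, ζ s with hη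
  have hηs : ContDiff ℝ (⊤ : ℕ∞) η := contDiff_intervalIntegral hζ T
  have hη' : deriv η = ζ := funext fun t =>
    (hζ.continuous.integral_hasStrictDerivAt T t).hasDerivAt.deriv
  have h0 : IsTest N fun _ _ => 0 := ⟨contDiff_const, fun _ _ _ => rfl⟩
  have h := hs.integral_weakIntegrand (h0.add_time hηs) (by simp [hη])
  have hz : ∀ q, weakIntegrand m A (fun x t => (0 : ℝ) + η t) q = m q.1 q.2 * ζ q.2 := by
    intro q
    rw [weakIntegrand_add_time h0 hηs, hη']
    have hpd : ∀ i : Fin N, pd i (fun _ => (0 : ℝ)) = fun _ => 0 := fun i => by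
      funext x
      simp [pd]
    simp [weakIntegrand, lap, grad, dotp, hpd]
  simp only [hz] at h
  rw [h, integral_mul_const, hd.2.2.1, zero_add, one_mul, hη]
  exact (intervalIntegral.integral_symm _ _).symm

lemma FPSol.ae_slice_eq_one (hT : 0 < T) (hd : FPData N K₀ m₀) (hs : FPSol N T γ' m₀ m A)
    {M : RN N × ℝ → ENNReal} (hMm : Measurable M)
    (hM : M =ᵐ[cylMeasure N T] fun q => ENNReal.ofReal (m q.1 q.2)) :
    ∀ᵐ t ∂(volume.restrict (Ioo 0 T)), ∫⁻ y in cube N, M (y, t) = 1 := by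
  set H : ℝ → ENNReal := fun t => ∫⁻ y in cube N, M (y, t) with hH
  have hHm : Measurable H := Measurable.lintegral_prod_left hMm
  have hMr : (fun q => (M q).toReal) =ᵐ[cylMeasure N T] fun q => m q.1 q.2 := by
    filter_upwards [hM] with q hq
    rw [hq, ENNReal.toReal_ofReal (hs.nonneg _ _)]
  have hMi : Integrable (fun q => (M q).toReal) (cylMeasure N T) := hs.int_m.congr hMr.symm
  have hHfin : ∫⁻ t in Ioo 0 T, H t ≠ ⊤ := by
    rw [← lintegral_cylMeasure hMm, lintegral_congr_ae hM]
    exact ((lintegral_ofReal_le_lintegral_enorm _).trans_lt hs.int_m.2).ne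
  have hHlt : ∀ᵐ t ∂(volume.restrict (Ioo 0 T)), H t < ⊤ := ae_lt_top hHm hHfin
  have hHr : Integrable (fun t => (H t).toReal) (volume.restrict (Ioo 0 T)) :=
    integrable_toReal_of_lintegral_ne_top hHm.aemeasurable hHfin
  have hslice : ∀ᵐ t ∂(volume.restrict (Ioo 0 T)),
      ∫ y in cube N, (M (y, t)).toReal = (H t).toReal := by
    filter_upwards [hHlt] with t ht
    have hMt : Measurable fun y => M (y, t) := hMm.comp measurable_prodMk_right
    exact integral_toReal hMt.aemeasurable (ae_lt_top hMt ht.ne)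
  have hzero : ∀ᵐ t, t ∈ Ioo 0 T → (H t).toReal - 1 = 0 := by
    refine isOpen_Ioo.ae_eq_zero_of_integral_contDiff_smul_eq_zero
      (IntegrableOn.locallyIntegrableOn (hHr.sub (integrable_const 1))) fun ζ hζ hζc hζs => ?_
    have hζb : ∃ C, ∀ t, ‖ζ t‖ ≤ C := hζ.continuous.bounded_above_of_compact_support hζc
    obtain ⟨C, hC⟩ := hζb
    have hζm : AEStronglyMeasurable ζ (volume.restrict (Ioo 0 T)) :=
      hζ.continuous.aestronglyMeasurable
    have i1 : Integrable (fun q : RN N × ℝ => (M q).toReal * ζ q.2) (cylMeasure N T) :=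
      hMi.mul_bdd (hζ.continuous.comp continuous_snd).aestronglyMeasurable
        (Eventually.of_forall fun q => hC q.2)
    have e1 : ∫ t in Ioo 0 T, ζ t * (H t).toReal = ∫ t in (0 : ℝ)..T, ζ t := by
      rw [← hs.integral_mul_time hd (hζ.of_le (by simp))]
      rw [integral_congr_ae (g := fun q : RN N × ℝ => (M q).toReal * ζ q.2)
        (by filter_upwards [hMr] with q hq; rw [hq])]
      rw [cylMeasure_eq_prod] at i1 ⊢
      rw [integral_prod_symm _ i1]
      refine integral_congr_ae ?_
      filter_upwards [hslice] with t ht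
      rw [integral_mul_const, ht, mul_comm]
    rw [← setIntegral_eq_integral_of_forall_compl_eq_zero (s := Ioo 0 T)
      (fun t ht => by rw [image_eq_zero_of_notMem_tsupport fun h => ht (hζs h), zero_smul])]
    simp only [smul_eq_mul, mul_sub, mul_one]
    rw [integral_sub (hHr.bdd_mul hζm (Eventually.of_forall hC))
      (hζ.continuous.integrable_of_hasCompactSupport hζc).integrableOn, e1,
      intervalIntegral.integral_of_le hT.le, integral_Ioc_eq_integral_Ioo, sub_self]
  filter_upwards [hHlt, (ae_restrict_iff' measurableSet_Ioo).2 hzero] with t h1 h2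
  rw [← ENNReal.toReal_eq_one_iff]
  linarith

end FokkerPlanck

/-- **Proposition 2.5**: for `0 ≤ α < γ'/N`, a superlinear power of `∫_Q m^{α+1}` is
controlled by the energy `E` of the Fokker–Planck equation. -/
theorem fokker_planck_energy_bound (N : ℕ) (hN : 1 ≤ N) (T : ℝ) (hT : 0 < T)
    (α γ' K₀ : ℝ) (hα : 0 ≤ α) (hγ' : 1 < γ') (hsub : α < γ' / N) (hK₀ : 0 ≤ K₀) :
    ∃ C > (0:ℝ), ∃ δ > (1:ℝ),
      ∀ (m₀ : RN N → ℝ) (m : RN N → ℝ → ℝ) (A : RN N → ℝ → RN N),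
        FPData N K₀ m₀ → FPSol N T γ' m₀ m A →
        IntegrableOn (fun q : RN N × ℝ => m q.1 q.2 ^ (α + 1)) (QQ N T) →
        (intQ N T (fun x t => m x t ^ (α + 1))) ^ δ
          ≤ C * (intQ N T (fun x t => euclNorm (A x t) ^ γ' * m x t) + 1) := by
  have hγ0 : 0 < γ' := by linarith
  have hu0 : 0 ≤ 1 / γ' := by positivity
  have hu1 : 0 ≤ 1 - 1 / γ' := by rw [sub_nonneg, div_le_one hγ0]; exact hγ'.le
  set c := ENNReal.ofReal (Real.exp (-((N : ℝ) / 4))) with hc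
  have hc0 : c ≠ 0 := by rw [hc]; exact (ENNReal.ofReal_pos.2 (Real.exp_pos _)).ne'
  have hct : c ≠ ⊤ := ENNReal.ofReal_ne_top
  set C₀ := ENNReal.ofReal ((1 + N * K₀) * profileMass N) with hC₀
  set C₁ := 2 * ENNReal.ofReal (1 + 40 * Real.pi ^ 2 * √T) with hC₁
  obtain ⟨C, hC, δ, hδ, hmain⟩ := exists_potential_bound hN T α γ' hα hγ' hsub (C₀ / c) (C₁ / c)
    (ENNReal.div_ne_top ENNReal.ofReal_ne_top hc0)
    (ENNReal.div_ne_top (by rw [hC₁]; finiteness) hc0)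
  refine ⟨(C.toReal + 1) * (T + 1), by positivity, δ, hδ, fun m₀ m A hd hs hinteg => ?_⟩
  have hα1 : 0 ≤ α + 1 := by linarith
  have hm1 : AEMeasurable (fun q => ENNReal.ofReal (m q.1 q.2)) (cylMeasure N T) :=
    hs.int_m.aestronglyMeasurable.aemeasurable.ennreal_ofReal
  have hm2 : AEMeasurable (fun q => ENNReal.ofReal (euclNorm (A q.1 q.2) ^ γ' * m q.1 q.2) +
      ENNReal.ofReal (m q.1 q.2)) (cylMeasure N T) :=
    hs.int_E.aestronglyMeasurable.aemeasurable.ennreal_ofReal.add hm1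
  have hEnn : ∀ q : RN N × ℝ, 0 ≤ euclNorm (A q.1 q.2) ^ γ' * m q.1 q.2 := fun q =>
    mul_nonneg (Real.rpow_nonneg (euclNorm_nonneg _) _) (hs.nonneg _ _)
  set M := hm1.mk _ with hMdef
  set Z := hm2.mk _ with hZdef
  have hMm : Measurable M := hm1.measurable_mk
  have hZm : Measurable Z := hm2.measurable_mk
  have hM : M =ᵐ[cylMeasure N T] _ := hm1.ae_eq_mk.symm
  have hZ : Z =ᵐ[cylMeasure N T] _ := hm2.ae_eq_mk.symm
  have hslice := hs.ae_slice_eq_one hT hd hMm hM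
  have hMint : ∫⁻ q, M q ∂(cylMeasure N T) = ENNReal.ofReal T := by
    rw [lintegral_cylMeasure hMm, lintegral_congr_ae hslice]
    simp
  have hpow : ∫⁻ q, M q ^ (α + 1) ∂(cylMeasure N T)
      = ENNReal.ofReal (intQ N T fun x t => m x t ^ (α + 1)) := by
    rw [intQ, ofReal_integral_eq_lintegral_ofReal hinteg
      (Eventually.of_forall fun q => Real.rpow_nonneg (hs.nonneg _ _) _)]
    refine lintegral_congr_ae ?_
    filter_upwards [hM] with q hq
    rw [hq, ENNReal.ofReal_rpow_of_nonneg (hs.nonneg _ _) hα1]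
  set E := intQ N T (fun x t => euclNorm (A x t) ^ γ' * m x t) with hE
  have hE0 : 0 ≤ E := integral_nonneg hEnn
  have hZint : ∫⁻ q, Z q ∂(cylMeasure N T) = ENNReal.ofReal (E + T) := by
    rw [lintegral_congr_ae hZ, lintegral_add_right' _ hm1, ← lintegral_congr_ae hM, hMint,
      ENNReal.ofReal_add hE0 hT.le, hE, intQ,
      ofReal_integral_eq_lintegral_ofReal hs.int_E (Eventually.of_forall hEnn)]
  set f : RN N × ℝ → ENNReal := fun q => Z q ^ (1 / γ') * M q ^ (1 - 1 / γ') with hf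
  have hfm : Measurable f := (hZm.pow_const _).mul (hMm.pow_const _)
  have hffin : ∫⁻ q, f q ∂(cylMeasure N T) ≠ ⊤ := by
    refine ((ENNReal.lintegral_mul_norm_pow_le hZm.aemeasurable hMm.aemeasurable hu0 hu1
      (by ring)).trans_lt ?_).ne
    rw [hZint, hMint]
    exact ENNReal.mul_lt_top (ENNReal.rpow_lt_top_of_nonneg hu0 ENNReal.ofReal_ne_top)
      (ENNReal.rpow_lt_top_of_nonneg hu1 ENNReal.ofReal_ne_top)
  have hUm : Measurable fun q => C₀ + C₁ * heatOp T (1 / 2) f q :=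
    ((measurable_heatOp T _ hfm).const_mul _).const_add _
  have hUfin : ∫⁻ q, (C₀ + C₁ * heatOp T (1 / 2) f q) ∂(cylMeasure N T) ≠ ⊤ := by
    rw [lintegral_add_left measurable_const, lintegral_const, cylMeasure_univ,
      lintegral_const_mul _ (measurable_heatOp T _ hfm)]
    have h1 : ∫⁻ q, heatOp T (1 / 2) f q ∂(cylMeasure N T) ≠ ⊤ :=
      ((lintegral_heatOp_le hfm).trans_lt (ENNReal.mul_lt_top
        (heatKerConst_lt_top zero_le_one (by norm_num)) hffin.lt_top)).ne
    rw [hC₀, hC₁]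
    finiteness
  have hae := ae_le_of_lintegral_cutKer_le hMm hUm hUfin fun ε hε q hq =>
    hs.lintegral_cutKer_le hT hγ' hd hM hZ hε hq
  have hpot : ∀ᵐ q ∂(cylMeasure N T), M q ≤ C₀ / c + C₁ / c * heatOp T (1 / 2) f q := by
    filter_upwards [hae] with q hq
    rw [← ENNReal.mul_div_right_comm, ← ENNReal.add_div,
      ENNReal.le_div_iff_mul_le (Or.inl hc0) (Or.inl hct), mul_comm]
    exact hq
  have hI0 : 0 ≤ intQ N T fun x t => m x t ^ (α + 1) :=
    integral_nonneg fun q => Real.rpow_nonneg (hs.nonneg _ _) _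
  have hb := hmain M Z hMm hZm (hslice.mono fun t ht => ht.le) hpot
    (by rw [hpow]; exact ENNReal.ofReal_ne_top)
  rw [hpow, hZint, ENNReal.ofReal_rpow_of_nonneg hI0 (by linarith), ← ENNReal.ofReal_toReal hC,
    ← ENNReal.ofReal_one, ← ENNReal.ofReal_add (by positivity) zero_le_one,
    ← ENNReal.ofReal_mul ENNReal.toReal_nonneg,
    ENNReal.ofReal_le_ofReal_iff (by positivity)] at hb
  have hCr : 0 ≤ C.toReal := ENNReal.toReal_nonneg
  calc _ ≤ C.toReal * (E + T + 1) := hb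
    _ ≤ (C.toReal + 1) * ((T + 1) * (E + 1)) := by
        gcongr
        · linarith
        · nlinarith
    _ = _ := by ring
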